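/- arXiv:1309.5544 — 2 statements merged into one kernel-verified Lean document; each statement's English description precedes it below -/
import Mathlib

section
/- For every alternating Turing machine M over Σ, the language L(M) accepted by M is inductive (Π¹₁). -/
namespace ATMPaper

/-- Actions of a Turing machine: overwrite the scanned symbol by a letter,
move the cursor backward (`left`), or forward (`right`). -/
inductive Act (Γ : Type) : Type
  | write : Γ → Act Γ
  | left : Act Γ
  | right : Act Γ

/-- A cursored tape `u γ̲ v`: the string `u` to the left of the cursor,
the scanned symbol `γ`, and the string `v` to the right. -/
abbrev Tape (Γ : Type) : Type := List Γ × Γ × List Γ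

/-- The scanned symbol of a cursored tape. -/
def Tape.scan {Γ : Type} (t : Tape Γ) : Γ := t.2.1

/-- The effect of an action on a cursored tape (with blank symbol `blank`):
moving forward past the right end extends the tape with a blank, and moving
backward at the left end leaves the cursor in place. -/
inductive ActStep {Γ : Type} (blank : Γ) : Act Γ → Tape Γ → Tape Γ → Prop
  | fwd (u : List Γ) (γ τ : Γ) (v : List Γ) :
      ActStep blank Act.right (u, γ, τ :: v) (u ++ [γ], τ, v)
  | fwdEnd (u : List Γ) (γ : Γ) :
      ActStep blank Act.right (u, γ, []) (u ++ [γ], blank, [])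
  | bwd (u : List Γ) (τ γ : Γ) (v : List Γ) :
      ActStep blank Act.left (u ++ [τ], γ, v) (u, τ, γ :: v)
  | bwdEnd (γ : Γ) (v : List Γ) :
      ActStep blank Act.left ([], γ, v) ([], γ, v)
  | write (u : List Γ) (γ τ : Γ) (v : List Γ) :
      ActStep blank (Act.write τ) (u, γ, v) (u, τ, v)

section Generic

variable {C : Type*} (isE : C → Bool) (step : C → C → Prop)

/-- A chain of steps `c = c₀ → ⋯ → cₙ = c'` (`n ≥ 0`) in which `c₀,…,cₙ₋₁`
are all existential. -/
inductive EChain : C → C → Prop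
  | refl (c : C) : EChain c c
  | step {c c' c'' : C} : isE c = true → step c c' → EChain c' c'' → EChain c c''

/-- A chain of steps `c = c₀ → ⋯ → cₙ = c'` (`n ≥ 0`) in which `c₀,…,cₙ₋₁`
are all universal. -/
inductive UChain : C → C → Prop
  | refl (c : C) : UChain c c
  | step {c c' c'' : C} : isE c = false → step c c' → UChain c' c'' → UChain c c''

/-- `c ⇑∃ c'` : `c'` is universal and reachable from `c` by a chain passing
only through existential configurations. -/
def EPivot (c c' : C) : Prop := EChain isE step c c' ∧ isE c' = false

/-- `c ⇑∀ c'` : `c'` is existential and reachable from `c` by a chain passing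
only through universal configurations. -/
def UPivot (c c' : C) : Prop := UChain isE step c c' ∧ isE c' = true

/-- The set `AC` of accepted configurations: the least set `S` such that
(i) an existential `c` with some pivot `c ⇑∃ c'`, `c' ∈ S`, is in `S`, and
(ii) a universal `c` all of whose pivots `c ⇑∀ c'` lie in `S` is in `S`. -/
inductive Accepted : C → Prop
  | ex {c c' : C} : isE c = true → EPivot isE step c c' → Accepted c' → Accepted c
  | univ {c : C} : isE c = false → (∀ c', UPivot isE step c c' → Accepted c') →
      Accepted c

/-- The set `RC` of rejected configurations: the least set `S` such that
(i) an existential `c` all of whose pivots `c ⇑∃ c'` lie in `S` is in `S`, and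
(ii) a universal `c` with some pivot `c ⇑∀ c'`, `c' ∈ S`, is in `S`. -/
inductive Rejected : C → Prop
  | ex {c : C} : isE c = true → (∀ c', EPivot isE step c c' → Rejected c') →
      Rejected c
  | univ {c c' : C} : isE c = false → UPivot isE step c c' → Rejected c' →
      Rejected c

end Generic

/-- An alternating Turing machine over input alphabet `α`, with (finite)
machine alphabet `Γ` into which `α` embeds, a blank symbol (not a letter
of `α`), a finite set `Q` of states each of which is existential
(`isE q = true`) or universal (`isE q = false`), a start state, and a
transition relation `δ`. -/
structure ATM (α Γ : Type) where
  ΓFin : Finite Γ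
  emb : α ↪ Γ
  blank : Γ
  blank_ne : ∀ a : α, emb a ≠ blank
  Q : Type
  QFin : Finite Q
  isE : Q → Bool
  start : Q
  δ : Q → Γ → Act Γ → Q → Prop

namespace ATM

variable {α Γ : Type} (M : ATM α Γ)

/-- A configuration: a state together with a cursored tape. -/
abbrev Cfg : Type := M.Q × Tape Γ

/-- A configuration is existential or universal according to its state. -/
def cfgE (c : M.Cfg) : Bool := M.isE c.1

/-- The one-step yield relation between configurations. -/
def Yield (c c' : M.Cfg) : Prop :=
  ∃ a : Act Γ, M.δ c.1 (Tape.scan c.2) a c'.1 ∧ ActStep M.blank a c.2 c'.2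

/-- `c ⇑∃ c'` for configurations of `M`. -/
def EPiv (c c' : M.Cfg) : Prop := ATMPaper.EPivot M.cfgE M.Yield c c'

/-- `c ⇑∀ c'` for configurations of `M`. -/
def UPiv (c c' : M.Cfg) : Prop := ATMPaper.UPivot M.cfgE M.Yield c c'

/-- `c` is an accepted configuration of `M`. -/
def Accepted (c : M.Cfg) : Prop := ATMPaper.Accepted M.cfgE M.Yield c

/-- `c` is a rejected configuration of `M`. -/
def Rejected (c : M.Cfg) : Prop := ATMPaper.Rejected M.cfgE M.Yield c

/-- The initial configuration `(s₀, ε, ⊔, w)` for input `w`. -/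
def init (w : List α) : M.Cfg := (M.start, ([], M.blank, w.map M.emb))

/-- `M` accepts the input string `w`. -/
def Accepts (w : List α) : Prop := M.Accepted (M.init w)

/-- `M` rejects the input string `w`. -/
def Rejects (w : List α) : Prop := M.Rejected (M.init w)

/-- The language `L(M)` accepted by `M`. -/
def Lang : Set (List α) := {w | M.Accepts w}

/-- The language `L̄(M)` rejected by `M`. -/
def coLang : Set (List α) := {w | M.Rejects w}

/-- `M` is total: every input is either accepted or rejected. -/
def Total : Prop := ∀ w : List α, M.Accepts w ∨ M.Rejects w

/-- `M` is one-sided: it has no accepted configurations, or no rejected ones. -/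
def OneSided : Prop :=
  (∀ c : M.Cfg, ¬ M.Accepted c) ∨ (∀ c : M.Cfg, ¬ M.Rejected c)

/-- The dual machine: same data, with existential and universal states
interchanged. -/
def dual : ATM α Γ :=
  ⟨M.ΓFin, M.emb, M.blank, M.blank_ne, M.Q, M.QFin,
    fun q => !M.isE q, M.start, M.δ⟩

/-- `M` is alternation well-founded: for no input `w` is there an infinite
sequence of yield-steps from the initial configuration for `w` in which the
type (existential/universal) changes infinitely often. -/
def AltWF : Prop :=
  ∀ w : List α, ¬∃ d : ℕ → M.Cfg, d 0 = M.init w ∧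
    (∀ i : ℕ, M.Yield (d i) (d (i + 1))) ∧
    (∀ n : ℕ, ∃ m : ℕ, n ≤ m ∧ M.cfgE (d m) ≠ M.cfgE (d (m + 1)))

/-- Every chain of yield-steps from an initial configuration of `M` has at
most `k` alternation-pivots, i.e. at most `k` indices at which the type of
the configuration changes. -/
def AltBound (k : ℕ) : Prop :=
  ∀ (w : List α) (n : ℕ) (d : ℕ → M.Cfg), d 0 = M.init w →
    (∀ i < n, M.Yield (d i) (d (i + 1))) →
    ((Finset.range n).filter fun i => M.cfgE (d i) ≠ M.cfgE (d (i + 1))).card ≤ k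

/-- `M` is a `Σ_k` machine: its start state is existential and every chain of
yield-steps from an initial configuration has at most `k` alternation-pivots. -/
def IsSigmaM (k : ℕ) : Prop := M.isE M.start = true ∧ M.AltBound k

/-- `M` is a `Π_k` machine: its start state is universal and every chain of
yield-steps from an initial configuration has at most `k` alternation-pivots;
moreover for `k = 1` no transition rule applies to any existential state. -/
def IsPiM (k : ℕ) : Prop :=
  M.isE M.start = false ∧ M.AltBound k ∧
    (k = 1 → ∀ (q : M.Q) (γ : Γ) (a : Act Γ) (q' : M.Q),
      M.δ q γ a q' → M.isE q = false)

end ATM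

/-- `AltQuant α k b P` is the statement `Q₁ x₁ Q₂ x₂ ⋯ Q_k x_k, P (x₁,…,x_k)`
where the quantifiers `Qᵢ` over `List α` alternate, starting with `∃` if
`b = true` and with `∀` if `b = false`. -/
def AltQuant (α : Type) : (k : ℕ) → Bool → ((Fin k → List α) → Prop) → Prop
  | 0, _, P => P fun i => i.elim0
  | k + 1, true, P => ∃ x : List α, AltQuant α k false fun v => P (Fin.cons x v)
  | k + 1, false, P => ∀ x : List α, AltQuant α k true fun v => P (Fin.cons x v)

/-- `L ⊆ Σ*` is `Σ⁰_k`: definable by `k` alternating quantifiers over strings,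
beginning with `∃`, applied to a computable relation. -/
def IsSigma0 (α : Type) [Primcodable α] (k : ℕ) (L : Set (List α)) : Prop :=
  ∃ R : List α × (Fin k → List α) → Prop, ComputablePred R ∧
    L = {w | AltQuant α k true fun v => R (w, v)}

/-- `L ⊆ Σ*` is `Π⁰_k`: definable by `k` alternating quantifiers over strings,
beginning with `∀`, applied to a computable relation. -/
def IsPi0 (α : Type) [Primcodable α] (k : ℕ) (L : Set (List α)) : Prop :=
  ∃ R : List α × (Fin k → List α) → Prop, ComputablePred R ∧
    L = {w | AltQuant α k false fun v => R (w, v)}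

/-- `L ⊆ Σ*` is inductive (`Π¹₁`): there is a computable relation
`R ⊆ Σ* × List (Σ*)` with
`L = {w | ∀ f : ℕ → Σ*, ∃ n, R (w, [f 0, …, f n])}`. -/
def IsInductive (α : Type) [Primcodable α] (L : Set (List α)) : Prop :=
  ∃ R : List α × List (List α) → Prop, ComputablePred R ∧
    L = {w | ∀ f : ℕ → List α, ∃ n : ℕ, R (w, (List.range (n + 1)).map f)}

/-- A two-tape alternating Turing machine: as `ATM`, but configurations carry
two cursored tapes, and transitions read both scanned symbols and perform an
action on each tape. -/
structure ATM2 (α Γ : Type) where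
  ΓFin : Finite Γ
  emb : α ↪ Γ
  blank : Γ
  blank_ne : ∀ a : α, emb a ≠ blank
  Q : Type
  QFin : Finite Q
  isE : Q → Bool
  start : Q
  δ : Q → Γ → Γ → Act Γ → Act Γ → Q → Prop

namespace ATM2

variable {α Γ : Type} (M : ATM2 α Γ)

/-- A configuration of a two-tape machine: a state and two cursored tapes. -/
abbrev Cfg : Type := M.Q × Tape Γ × Tape Γ

/-- A configuration is existential or universal according to its state. -/
def cfgE (c : M.Cfg) : Bool := M.isE c.1

/-- The one-step yield relation of a two-tape machine. -/
def Yield (c c' : M.Cfg) : Prop :=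
  ∃ a₀ a₁ : Act Γ, M.δ c.1 (Tape.scan c.2.1) (Tape.scan c.2.2) a₀ a₁ c'.1 ∧
    ActStep M.blank a₀ c.2.1 c'.2.1 ∧ ActStep M.blank a₁ c.2.2 c'.2.2

/-- `c ⇑∃ c'` for configurations of `M`. -/
def EPiv (c c' : M.Cfg) : Prop := ATMPaper.EPivot M.cfgE M.Yield c c'

/-- `c ⇑∀ c'` for configurations of `M`. -/
def UPiv (c c' : M.Cfg) : Prop := ATMPaper.UPivot M.cfgE M.Yield c c'

/-- `c` is an accepted configuration of `M`. -/
def Accepted (c : M.Cfg) : Prop := ATMPaper.Accepted M.cfgE M.Yield c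

/-- `c` is a rejected configuration of `M`. -/
def Rejected (c : M.Cfg) : Prop := ATMPaper.Rejected M.cfgE M.Yield c

/-- `M` accepts `w`: the configuration reached after the (deterministic)
pre-processing phase — the start state with the input copied onto both
tapes — is accepted. -/
def Accepts (w : List α) : Prop :=
  M.Accepted (M.start, ([], M.blank, w.map M.emb), ([], M.blank, w.map M.emb))

/-- `M` rejects `w`. -/
def Rejects (w : List α) : Prop :=
  M.Rejected (M.start, ([], M.blank, w.map M.emb), ([], M.blank, w.map M.emb))

end ATM2

/-- The combined two-tape machine `M` of two single-tape machines `M₀`, `M₁`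
over a common alphabet. Its states are triples `⟨q₀,q₁,j⟩` (`j : Bool`, with
`false` for `0` and `true` for `1`), typed according to `q_j`. In control
`j = 0`, a rule `(q₀,γ₀,a,p₀)` of `M₀` acts by `a` on tape `0`, leaves tape `1`
unchanged (re-writing its scanned symbol), and passes to control `0` if `q₀`
and `p₀` are both universal, and to control `1` otherwise; symmetrically, in
control `j = 1`, a rule `(q₁,γ₁,a,p₁)` of `M₁` acts by `a` on tape `1`, leaves
tape `0` unchanged, and passes to control `1` if `q₁` and `p₁` are both
existential, and to control `0` otherwise. -/
def combine {α Γ : Type} (M₀ M₁ : ATM α Γ) : ATM2 α Γ where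
  ΓFin := M₀.ΓFin
  emb := M₀.emb
  blank := M₀.blank
  blank_ne := M₀.blank_ne
  Q := M₀.Q × M₁.Q × Bool
  QFin := by haveI := M₀.QFin; haveI := M₁.QFin; infer_instance
  isE := fun s => cond s.2.2 (M₁.isE s.2.1) (M₀.isE s.1)
  start := (M₀.start, M₁.start, false)
  δ := fun s γ₀ γ₁ a₀ a₁ p =>
    (s.2.2 = false ∧ ∃ p₀ : M₀.Q, M₀.δ s.1 γ₀ a₀ p₀ ∧ a₁ = Act.write γ₁ ∧
        p = (p₀, s.2.1, !(!(M₀.isE s.1) && !(M₀.isE p₀)))) ∨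
    (s.2.2 = true ∧ ∃ p₁ : M₁.Q, M₁.δ s.2.1 γ₁ a₁ p₁ ∧ a₀ = Act.write γ₀ ∧
        p = (s.1, p₁, M₁.isE s.2.1 && M₁.isE p₁))

end ATMPaper

namespace ATMPaper

open Encodable

section Ranks

variable {C : Type*} {isE : C → Bool} {step : C → C → Prop}

/-- A function `h` is a rejection ranking when its support is closed under the steps of
existential configurations, and each universal configuration in the support has a step inside
the support to an existential configuration or to one of smaller value. -/
def IsRanking (isE : C → Bool) (step : C → C → Prop) (h : C → ℕ) : Prop :=
  ∀ c, 0 < h c →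
    (isE c = true → ∀ c', step c c' → 0 < h c') ∧
    (isE c = false → ∃ c', step c c' ∧ 0 < h c' ∧ (isE c' = true ∨ h c' < h c))

theorem IsRanking.pos_of_eChain {h : C → ℕ} (hh : IsRanking isE step h) {c c' : C}
    (hc : EChain isE step c c') : 0 < h c → 0 < h c' := by
  induction hc with
  | refl => exact id
  | step he hs _ ih => exact fun hp => ih ((hh _ hp).1 he _ hs)

theorem IsRanking.exists_uPivot {h : C → ℕ} (hh : IsRanking isE step h) (c : C)
    (hu : isE c = false) (hp : 0 < h c) : ∃ c', UPivot isE step c c' ∧ 0 < h c' := by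
  induction hn : h c using Nat.strong_induction_on generalizing c with
  | _ n ih =>
    obtain ⟨c', hs, hp', hc'⟩ := (hh c hp).2 hu
    by_cases he : isE c' = true
    · exact ⟨c', ⟨.step hu hs (.refl _), he⟩, hp'⟩
    · obtain ⟨d, hd, hpd⟩ :=
        ih (h c') (hn ▸ hc'.resolve_left he) c' (by simpa using he) hp' rfl
      exact ⟨d, ⟨.step hu hs hd.1, hd.2⟩, hpd⟩

theorem IsRanking.eq_zero_of_accepted {h : C → ℕ} (hh : IsRanking isE step h) {c : C}
    (hc : Accepted isE step c) : h c = 0 := by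
  induction hc with
  | ex _ hp _ ih =>
    by_contra h0
    exact (hh.pos_of_eChain hp.1 (Nat.pos_of_ne_zero h0)).ne' ih
  | univ hu _ ih =>
    by_contra h0
    obtain ⟨d, hd, hpd⟩ := hh.exists_uPivot _ hu (Nat.pos_of_ne_zero h0)
    exact hpd.ne' (ih d hd)

/-- There is a chain of `n` steps from universal configurations leading to an existential
configuration that is not accepted. -/
def ReachesUnaccepted (isE : C → Bool) (step : C → C → Prop) : ℕ → C → Prop
  | 0, c => isE c = true ∧ ¬ Accepted isE step c
  | n + 1, c => isE c = false ∧ ∃ c', step c c' ∧ ReachesUnaccepted isE step n c'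

theorem ReachesUnaccepted.exists_uChain {n : ℕ} {c : C}
    (hc : ReachesUnaccepted isE step n c) :
    ∃ c', UChain isE step c c' ∧ isE c' = true ∧ ¬ Accepted isE step c' := by
  induction n generalizing c with
  | zero => exact ⟨c, .refl c, hc⟩
  | succ n ih =>
    obtain ⟨hu, d, hs, hd⟩ := hc
    obtain ⟨c', hch, h'⟩ := ih hd
    exact ⟨c', .step hu hs hch, h'⟩

theorem ReachesUnaccepted.not_accepted {n : ℕ} {c : C}
    (hc : ReachesUnaccepted isE step n c) : ¬ Accepted isE step c := by
  cases n with
  | zero => exact hc.2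
  | succ n =>
    obtain ⟨c', hch, he, hna⟩ := hc.exists_uChain
    intro ha
    cases ha with
    | ex he' => simp [hc.1] at he'
    | univ _ hall => exact hna (hall c' ⟨hch, he⟩)

theorem UChain.exists_reachesUnaccepted {c c' : C} (hc : UChain isE step c c')
    (he : isE c' = true) (hna : ¬ Accepted isE step c') :
    ∃ n, ReachesUnaccepted isE step n c := by
  induction hc with
  | refl => exact ⟨0, he, hna⟩
  | step hu hs _ ih =>
    obtain ⟨n, hn⟩ := ih he hna
    exact ⟨n + 1, hu, _, hs, hn⟩

theorem exists_reachesUnaccepted_iff {c : C} :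
    (∃ n, ReachesUnaccepted isE step n c) ↔ ¬ Accepted isE step c := by
  refine ⟨fun ⟨_, h⟩ => h.not_accepted, fun hna => ?_⟩
  by_cases he : isE c = true
  · exact ⟨0, he, hna⟩
  · have hu : isE c = false := by simpa using he
    by_contra hcon
    refine hna (.univ hu fun c' hp => ?_)
    by_contra hna'
    exact hcon (hp.1.exists_reachesUnaccepted hp.2 hna')

theorem Accepted.of_step {c c' : C} (he : isE c = true) (hs : step c c')
    (hc : Accepted isE step c') : Accepted isE step c := by
  cases hc with
  | univ hu hall => exact .ex he ⟨.step he hs (.refl _), hu⟩ (.univ hu hall)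
  | ex _ hp ha => exact .ex he ⟨.step he hs hp.1, hp.2⟩ ha

theorem exists_isRanking (isE : C → Bool) (step : C → C → Prop) :
    ∃ h : C → ℕ, IsRanking isE step h ∧ ∀ c, ¬ Accepted isE step c → 0 < h c := by
  classical
  let h : C → ℕ := fun c =>
    if hc : ∃ n, ReachesUnaccepted isE step n c then Nat.find hc + 1 else 0
  have hpos : ∀ c, 0 < h c ↔ ¬ Accepted isE step c := fun c => by
    rw [← exists_reachesUnaccepted_iff]
    by_cases hc : ∃ n, ReachesUnaccepted isE step n c <;> simp [h, hc]
  refine ⟨h, fun c hc => ⟨fun he c' hs => ?_, fun hu => ?_⟩, fun c => (hpos c).2⟩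
  · exact (hpos c').2 fun ha => (hpos c).1 hc (ha.of_step he hs)
  · have hex := exists_reachesUnaccepted_iff.2 ((hpos c).1 hc)
    have hval : h c = Nat.find hex + 1 := dif_pos hex
    have hfind := Nat.find_spec hex
    cases hn : Nat.find hex with
    | zero =>
      rw [hn] at hfind
      simp [hfind.1] at hu
    | succ n =>
      rw [hn] at hfind
      obtain ⟨-, c', hs, hr⟩ := hfind
      have hex' : ∃ n, ReachesUnaccepted isE step n c' := ⟨n, hr⟩
      have hval' : h c' = Nat.find hex' + 1 := dif_pos hex'
      have hle : Nat.find hex' ≤ n := Nat.find_min' hex' hr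
      exact ⟨c', hs, by omega, .inr (by omega)⟩

end Ranks

section Violation

variable {C : Type*} [Primcodable C]

/-- The initial segment `l` of a function on codes shows that this function is not a rejection
ranking at `c`. -/
def Violates (isE : C → Bool) (succ : C → List C) (l : List ℕ) (c : C) : Prop :=
  0 < l.getD (encode c) 0 ∧
    ((isE c = true ∧ ∃ c' ∈ succ c, l[encode c']? = some 0) ∨
      (isE c = false ∧ ∀ c' ∈ succ c, l[encode c']? = some 0 ∨
        (isE c' = false ∧ l.getD (encode c) 0 ≤ l.getD (encode c') 0)))

theorem primrecRel_violates {isE : C → Bool} {succ : C → List C}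
    (hE : Primrec isE) (hsucc : Primrec succ) : PrimrecRel (Violates isE succ) := by
  have hval : Primrec₂ fun (l : List ℕ) (c : C) => l.getD (encode c) 0 :=
    (Primrec.list_getD 0).comp Primrec.fst (Primrec.encode.comp Primrec.snd)
  have hzero : PrimrecRel fun (c : C) (l : List ℕ) => l[encode c]? = some 0 :=
    Primrec.eq.comp
      (Primrec.list_getElem?.comp Primrec.snd (Primrec.encode.comp Primrec.fst))
      (Primrec.const _)
  have hE' (b : Bool) : PrimrecPred fun c : C => isE c = b :=
    Primrec.eq.comp hE (Primrec.const b)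
  have hsnd : Primrec fun p : List ℕ × C => succ p.2 := hsucc.comp Primrec.snd
  have hex : PrimrecPred fun p : List ℕ × C => ∃ c' ∈ succ p.2, p.1[encode c']? = some 0 :=
    hzero.exists_mem_list.comp hsnd Primrec.fst
  have hrel : PrimrecRel fun (c' : C) (p : List ℕ × C) => p.1[encode c']? = some 0 ∨
      (isE c' = false ∧ p.1.getD (encode p.2) 0 ≤ p.1.getD (encode c') 0) :=
    (hzero.comp Primrec.fst (Primrec.fst.comp Primrec.snd)).or
      (((hE' false).comp Primrec.fst).and
        (Primrec.nat_le.comp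
          (hval.comp (Primrec.fst.comp Primrec.snd) (Primrec.snd.comp Primrec.snd))
          (hval.comp (Primrec.fst.comp Primrec.snd) Primrec.fst)))
  have hall := hrel.forall_mem_list.comp hsnd Primrec.id
  exact (Primrec.nat_lt.comp (Primrec.const 0) hval).and
    ((((hE' true).comp Primrec.snd).and hex).or (((hE' false).comp Primrec.snd).and hall))

/-- The relation witnessing inductiveness of the language of a recursively presented alternating
system: the lengths of the strings in the list are values of a function on codes that vanishes at
the initial configuration or violates the ranking condition at the configuration named by the
length of the list. -/
def RefutesRanking {α : Type} (isE : C → Bool) (succ : C → List C) (init : List α → C)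
    (p : List α × List (List α)) : Prop :=
  (p.2.map List.length)[encode (init p.1)]? = some 0 ∨
    ∃ c ∈ (decode (α := C) p.2.length.unpair.1).toList,
      Violates isE succ (p.2.map List.length) c

theorem primrecPred_refutesRanking {α : Type} [Primcodable α] {isE : C → Bool}
    {succ : C → List C} {init : List α → C} (hE : Primrec isE) (hsucc : Primrec succ)
    (hinit : Primrec init) : PrimrecPred (RefutesRanking isE succ init) := by
  have hlen : Primrec fun p : List α × List (List α) => p.2.map List.length :=
    Primrec.list_map Primrec.snd (Primrec.list_length.comp Primrec.snd)
  have hdec : Primrec fun p : List α × List (List α) =>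
      (decode (α := C) p.2.length.unpair.1).toList :=
    Primrec.optionToList.comp (Primrec.decode.comp (Primrec.fst.comp
      (Primrec.unpair.comp (Primrec.list_length.comp Primrec.snd))))
  have hviol : PrimrecRel fun (c : C) (l : List ℕ) => Violates isE succ l c :=
    (primrecRel_violates hE hsucc).comp Primrec.snd Primrec.fst
  exact (Primrec.eq.comp
    (Primrec.list_getElem?.comp hlen (Primrec.encode.comp (hinit.comp Primrec.fst)))
    (Primrec.const _)).or (hviol.exists_mem_list.comp hdec hlen)

theorem getElem?_lengths {α : Type} (f : ℕ → List α) (n k : ℕ) :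
    (((List.range (n + 1)).map f).map List.length)[k]? =
      if k < n + 1 then some (f k).length else none := by
  by_cases h : k < n + 1 <;> simp [h]

theorem getD_lengths {α : Type} (f : ℕ → List α) (n k : ℕ) :
    (((List.range (n + 1)).map f).map List.length).getD k 0 =
      if k < n + 1 then (f k).length else 0 := by
  rw [List.getD_eq_getElem?_getD, getElem?_lengths]
  split_ifs <;> rfl

/-- Acceptance in a recursively presented, finitely branching alternating system is
inductive. -/
theorem isInductive_accepted {α : Type} [Primcodable α] [Nonempty α] {isE : C → Bool}
    {step : C → C → Prop} {succ : C → List C} {init : List α → C}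
    (hstep : ∀ c c', c' ∈ succ c ↔ step c c')
    (hE : Primrec isE) (hsucc : Primrec succ) (hinit : Primrec init) :
    IsInductive α {w | Accepted isE step (init w)} := by
  refine ⟨RefutesRanking isE succ init,
    (primrecPred_refutesRanking hE hsucc hinit).computablePred, ?_⟩
  ext w
  simp only [Set.mem_ofPred_eq]
  constructor
  · intro hacc f
    by_contra! hcon
    have hrank : IsRanking isE step fun c => (f (encode c)).length := by
      intro c hc
      by_contra hbad
      obtain ⟨b, hb⟩ := ((succ c).map encode).toFinset.bddAbove
      have hbc : ∀ c', c' ∈ succ c → encode c' ≤ b := fun c' h' =>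
        hb (List.mem_toFinset.2 (List.mem_map_of_mem h'))
      obtain ⟨n, hn⟩ : ∃ n, n + 1 = Nat.pair (encode c) (encode c + b + 1) :=
        ⟨_, Nat.sub_add_cancel ((Nat.le_add_left 1 _).trans (Nat.right_le_pair _ _))⟩
      have hle : encode c + b + 1 ≤ n + 1 := hn ▸ Nat.right_le_pair _ _
      have hcn : encode c < n + 1 := by omega
      have hsn : ∀ c' ∈ succ c, encode c' < n + 1 := fun c' h' => by
        have := hbc c' h'
        omega
      refine hcon n (.inr ⟨c, by simp [hn], ?_⟩)
      simp only [Violates, getElem?_lengths, getD_lengths, if_pos hcn]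
      refine ⟨hc, ?_⟩
      by_cases he : isE c = true
      · refine .inl ⟨he, ?_⟩
        by_contra! hz
        refine hbad ⟨fun _ c' hs => ?_, fun hu => by simp [he] at hu⟩
        have h' := (hstep c c').2 hs
        have := hz c' h'
        rw [if_pos (hsn c' h')] at this
        exact Nat.pos_of_ne_zero fun h0 => this (congrArg some h0)
      · refine .inr ⟨by simpa using he, fun c' h' => ?_⟩
        rw [if_pos (hsn c' h'), if_pos (hsn c' h')]
        by_contra! hz
        refine hbad ⟨fun h => (he h).elim, fun _ => ⟨c', (hstep c c').1 h', ?_, ?_⟩⟩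
        · exact Nat.pos_of_ne_zero fun h0 => hz.1 (congrArg some h0)
        · by_cases he' : isE c' = true
          · exact .inl he'
          · exact .inr (hz.2 (by simpa using he'))
    refine hcon (encode (init w)) (.inl ?_)
    rw [getElem?_lengths, if_pos (Nat.lt_succ_self _)]
    exact congrArg some (hrank.eq_zero_of_accepted hacc)
  · intro hall
    by_contra hna
    obtain ⟨h, hrank, hpos⟩ := exists_isRanking isE step
    obtain ⟨a⟩ := ‹Nonempty α›
    obtain ⟨n, hn⟩ := hall fun k =>
      List.replicate ((decode (α := C) k).elim 0 h) a
    rcases hn with hn | ⟨c, -, hc, hv⟩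
    · simp only [getElem?_lengths, List.length_replicate, encodek, Option.elim_some] at hn
      split_ifs at hn
      exact (hpos _ hna).ne' (Option.some.inj hn)
    · simp only [getElem?_lengths, getD_lengths, List.length_replicate, encodek,
        Option.elim_some] at hc hv
      split_ifs at hc hv with hcn
      · obtain ⟨h₁, h₂⟩ := hrank c hc
        rcases hv with ⟨he, c', hs, hz⟩ | ⟨hu, hs⟩
        · split_ifs at hz
          exact (h₁ he c' ((hstep c c').1 hs)).ne' (Option.some.inj hz)
        · obtain ⟨c', hst, hp, hor⟩ := h₂ hu
          have := hs c' ((hstep c c').2 hst)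
          split_ifs at this <;> grind
      · exact absurd hc (lt_irrefl 0)

end Violation

section Tapes

variable {Γ : Type}

/-- The result of applying an action to a cursored tape. -/
def Act.apply (blank : Γ) : Act Γ → Tape Γ → Tape Γ
  | .write τ, t => (t.1, τ, t.2.2)
  | .right, t => (t.1 ++ [t.2.1], t.2.2.headD blank, t.2.2.tail)
  | .left, t => t.1.reverse.casesOn ([], t.2) fun τ r => (r.reverse, τ, t.2.1 :: t.2.2)

theorem actStep_iff {blank : Γ} {a : Act Γ} {t t' : Tape Γ} :
    ActStep blank a t t' ↔ t' = a.apply blank t := by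
  constructor
  · rintro (_ | _ | _ | _ | _) <;> simp [Act.apply]
  · rintro rfl
    obtain ⟨u, γ, v⟩ := t
    cases a with
    | write τ => exact .write u γ τ v
    | right =>
      cases v with
      | nil => exact .fwdEnd u γ
      | cons τ v => exact .fwd u γ τ v
    | left =>
      rcases u.eq_nil_or_concat with rfl | ⟨u, τ, rfl⟩
      · exact .bwdEnd γ v
      · simpa [Act.apply] using ActStep.bwd (blank := blank) u τ γ v

theorem Act.primrec_apply [Primcodable Γ] (blank : Γ) (a : Act Γ) :
    Primrec (a.apply blank) := by
  have hv : Primrec fun t : Tape Γ => t.2.2 := Primrec.snd.comp Primrec.snd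
  have hγ : Primrec fun t : Tape Γ => t.2.1 := Primrec.fst.comp Primrec.snd
  cases a with
  | write τ => exact Primrec.fst.pair ((Primrec.const τ).pair hv)
  | right =>
    refine (Primrec.list_append.comp Primrec.fst
      (Primrec.list_cons.comp hγ (Primrec.const []))).pair (Primrec.pair ?_ ?_)
    · exact (Primrec.option_getD.comp (Primrec.list_head?.comp hv)
        (Primrec.const blank)).of_eq fun t => by simp
    · exact Primrec.list_tail.comp hv
  | left =>
    have hcons : Primrec fun p : Tape Γ × Γ × List Γ =>
        ((p.2.2.reverse, p.2.1, p.1.2.1 :: p.1.2.2) : Tape Γ) :=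
      (Primrec.list_reverse.comp (Primrec.snd.comp Primrec.snd)).pair
        ((Primrec.fst.comp Primrec.snd).pair
          (Primrec.list_cons.comp (hγ.comp Primrec.fst) (hv.comp Primrec.fst)))
    exact (Primrec.list_casesOn (Primrec.list_reverse.comp Primrec.fst)
      ((Primrec.const []).pair Primrec.snd) hcons.to₂).of_eq fun t => by
        simp only [Act.apply]

instance [Finite Γ] : Finite (Act Γ) := by
  refine Finite.of_injective (β := Option (Option Γ)) (fun
    | .write τ => some (some τ)
    | .left => some none
    | .right => none) ?_
  rintro (_ | _ | _) (_ | _ | _) <;> simp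

end Tapes

namespace ATM

variable {α Γ : Type} (M : ATM α Γ)

open Classical in
/-- The successors of a configuration by transitions whose action and target state are in a
given list. -/
noncomputable def succIn (L : List (Act Γ × M.Q)) (c : M.Cfg) : List M.Cfg :=
  L.foldr (fun p r =>
    if M.δ c.1 (Tape.scan c.2) p.1 p.2 then (p.2, p.1.apply M.blank c.2) :: r else r) []

theorem mem_succIn {L : List (Act Γ × M.Q)} {c c' : M.Cfg} :
    c' ∈ M.succIn L c ↔ ∃ p ∈ L, M.δ c.1 (Tape.scan c.2) p.1 p.2 ∧
      c' = (p.2, p.1.apply M.blank c.2) := by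
  induction L with
  | nil => simp [succIn]
  | cons p L ih =>
    rw [List.exists_mem_cons_iff, ← ih]
    simp only [succIn, List.foldr_cons]
    split_ifs with h <;> simp [h]

theorem mem_succIn_iff_yield {L : List (Act Γ × M.Q)} (hL : ∀ p, p ∈ L) (c c' : M.Cfg) :
    c' ∈ M.succIn L c ↔ M.Yield c c' := by
  simp only [mem_succIn, Yield, actStep_iff]
  constructor
  · rintro ⟨p, -, hδ, rfl⟩
    exact ⟨p.1, hδ, rfl⟩
  · rintro ⟨a, hδ, ht⟩
    exact ⟨(a, c'.1), hL _, hδ, Prod.ext rfl ht⟩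

theorem primrec_succIn [Primcodable Γ] [Primcodable M.Q] [Finite Γ] [Finite M.Q]
    (L : List (Act Γ × M.Q)) : Primrec (M.succIn L) := by
  classical
  induction L with
  | nil => exact Primrec.const []
  | cons p L ih =>
    have hδ : PrimrecPred fun x : M.Q × Γ => M.δ x.1 x.2 p.1 p.2 :=
      (Primrec.dom_finite _).primrecPred
    exact Primrec.ite
      (hδ.comp (Primrec.fst.pair (Primrec.fst.comp (Primrec.snd.comp Primrec.snd))))
      (Primrec.list_cons.comp
        ((Primrec.const p.2).pair ((p.1.primrec_apply M.blank).comp Primrec.snd)) ih) ih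

theorem isInductive_lang_of_nonempty [Primcodable α] [Nonempty α] :
    IsInductive α M.Lang := by
  have := M.ΓFin
  have := M.QFin
  have : Finite α := Finite.of_injective M.emb M.emb.injective
  let _ : Primcodable Γ := Primcodable.ofEquiv _ (Finite.equivFin Γ)
  let _ : Primcodable M.Q := Primcodable.ofEquiv _ (Finite.equivFin M.Q)
  obtain ⟨L, hL⟩ := Finite.exists_univ_list (Act Γ × M.Q)
  have hinit : Primrec M.init :=
    (Primrec.const M.start).pair ((Primrec.const []).pair ((Primrec.const M.blank).pair
      (Primrec.list_map Primrec.id ((Primrec.dom_finite M.emb).comp Primrec.snd))))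
  exact isInductive_accepted (M.mem_succIn_iff_yield hL.2)
    ((Primrec.dom_finite M.isE).comp Primrec.fst) (M.primrec_succIn L) hinit

end ATM

theorem isInductive_of_isEmpty {α : Type} [Primcodable α] [IsEmpty α] (L : Set (List α)) :
    IsInductive α L := by
  classical
  refine ⟨fun _ => [] ∈ L, (Primrec.const (decide ([] ∈ L))).primrecPred.computablePred, ?_⟩
  ext w
  simp [Subsingleton.elim w []]

end ATMPaper

open ATMPaper in
/-- for every alternating Turing machine `M` over `Σ`, the
language `L(M)` accepted by `M` is inductive (`Π¹₁`). -/
theorem stmt14 {α Γ : Type} [Primcodable α] (M : ATM α Γ) :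
    IsInductive α M.Lang := by
  rcases isEmpty_or_nonempty α with h | h
  · exact isInductive_of_isEmpty M.Lang
  · exact M.isInductive_lang_of_nonempty
end

section
/- Every inductive (Π¹₁) language L ⊆ Σ* is accepted by some alternating Turing machine over Σ, i.e., L = L(M) for some ATM M. -/
namespace ATMPaper

open Relation

section Machine

variable {Γ : Type}

/-- A one-way infinite tape seen as a cursor position and a content function. -/
abbrev FTape (Γ : Type) : Type := ℕ × (ℕ → Γ)

/-- The effect of an action on a tape seen as a function. -/
def Act.run : Act Γ → FTape Γ → FTape Γ
  | .write τ, t => (t.1, Function.update t.2 t.1 τ)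
  | .left, t => (t.1 - 1, t.2)
  | .right, t => (t.1 + 1, t.2)

/-- The functional view of a cursored tape. -/
def Tape.toF (blank : Γ) (t : Tape Γ) : FTape Γ :=
  (t.1.length, fun i => (t.1 ++ t.2.1 :: t.2.2).getD i blank)

theorem Tape.toF_scan (blank : Γ) (t : Tape Γ) :
    (t.toF blank).2 (t.toF blank).1 = t.scan := by
  simp [Tape.toF, Tape.scan]

theorem ActStep.toF_eq {blank : Γ} {a : Act Γ} {t t' : Tape Γ} (h : ActStep blank a t t') :
    t'.toF blank = a.run (t.toF blank) := by
  cases h with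
  | fwd u γ τ v => simp [Tape.toF, Act.run]
  | fwdEnd u γ =>
    simp only [Tape.toF, Act.run, List.length_append, List.length_singleton, Prod.mk.injEq,
      true_and]
    funext i
    rw [List.append_assoc]
    simp only [List.getD_eq_getElem?_getD, List.getElem?_append, List.singleton_append]
    split_ifs with h
    · rfl
    · obtain h | h | ⟨k, h⟩ : i - u.length = 0 ∨ i - u.length = 1 ∨ ∃ k, i - u.length = k + 2 := by
        rcases i - u.length with _ | _ | k <;> simp
      all_goals simp [h]
  | bwd u τ γ v => simp [Tape.toF, Act.run]
  | bwdEnd γ v => simp [Tape.toF, Act.run]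
  | write u γ τ v =>
    simp only [Tape.toF, Act.run, Prod.mk.injEq, true_and]
    funext i
    simp only [Function.update_apply, List.getD_eq_getElem?_getD, List.getElem?_append]
    obtain h | h | h := lt_trichotomy i u.length
    · simp [h, h.ne]
    · simp [h]
    · obtain ⟨k, rfl⟩ := Nat.exists_eq_add_of_lt h
      have : u.length + k + 1 - u.length = k + 1 := by omega
      simp [h.ne', h.not_gt, this]

theorem ActStep.exists_step (blank : Γ) (a : Act Γ) (t : Tape Γ) :
    ∃ t', ActStep blank a t t' := by
  obtain ⟨u, γ, v⟩ := t
  cases a with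
  | write τ => exact ⟨_, .write u γ τ v⟩
  | left =>
    rcases u.eq_nil_or_concat with rfl | ⟨u, τ, rfl⟩
    · exact ⟨_, .bwdEnd γ v⟩
    · rw [List.concat_eq_append]; exact ⟨_, .bwd u τ γ v⟩
  | right =>
    cases v with
    | nil => exact ⟨_, .fwdEnd u γ⟩
    | cons τ v => exact ⟨_, .fwd u γ τ v⟩

/-- Nondeterministic tape programs: regular expressions over guarded actions. -/
inductive Prog (Γ : Type) : Type
  | act : (Γ → Act Γ → Prop) → Prog Γ
  | seq : Prog Γ → Prog Γ → Prog Γ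
  | alt : Prog Γ → Prog Γ → Prog Γ
  | star : Prog Γ → Prog Γ

namespace Prog

/-- The input-output relation of a program. -/
def Rel : Prog Γ → FTape Γ → FTape Γ → Prop
  | act d => fun t t' => ∃ a, d (t.2 t.1) a ∧ t' = a.run t
  | seq p q => Comp p.Rel q.Rel
  | alt p q => fun t t' => p.Rel t t' ∨ q.Rel t t'
  | star p => ReflTransGen p.Rel

/-- The input-output relation of a stack of programs still to be executed. -/
def Sem : List (Prog Γ) → FTape Γ → FTape Γ → Prop
  | [] => Eq
  | p :: k => Comp p.Rel (Sem k)

theorem sem_singleton (p : Prog Γ) : Sem [p] = p.Rel := by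
  funext t t'
  simp [Sem, Comp]

/-- The transition rules of the machine whose states are stacks of programs. -/
inductive Step : List (Prog Γ) → Γ → Act Γ → List (Prog Γ) → Prop
  | act {d : Γ → Act Γ → Prop} {γ : Γ} {a : Act Γ} (k : List (Prog Γ)) :
      d γ a → Step (act d :: k) γ a k
  | seq (p q : Prog Γ) (k : List (Prog Γ)) (γ : Γ) :
      Step (seq p q :: k) γ (.write γ) (p :: q :: k)
  | altLeft (p q : Prog Γ) (k : List (Prog Γ)) (γ : Γ) :
      Step (alt p q :: k) γ (.write γ) (p :: k)
  | altRight (p q : Prog Γ) (k : List (Prog Γ)) (γ : Γ) :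
      Step (alt p q :: k) γ (.write γ) (q :: k)
  | starNil (p : Prog Γ) (k : List (Prog Γ)) (γ : Γ) :
      Step (star p :: k) γ (.write γ) k
  | starCons (p : Prog Γ) (k : List (Prog Γ)) (γ : Γ) :
      Step (star p :: k) γ (.write γ) (p :: star p :: k)

/-- The stacks that occur while executing `p :: k`, before reaching `k`. -/
def supp : Prog Γ → List (Prog Γ) → Set (List (Prog Γ))
  | act d, k => {act d :: k}
  | seq p q, k => insert (seq p q :: k) (p.supp (q :: k) ∪ q.supp k)
  | alt p q, k => insert (alt p q :: k) (p.supp k ∪ q.supp k)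
  | star p, k => insert (star p :: k) (p.supp (star p :: k))

theorem mem_supp_self (p : Prog Γ) (k : List (Prog Γ)) : p :: k ∈ p.supp k := by
  cases p <;> simp [supp]

theorem supp_finite (p : Prog Γ) (k : List (Prog Γ)) : (p.supp k).Finite := by
  induction p generalizing k with
  | act d => exact Set.finite_singleton _
  | seq p q hp hq => exact ((hp _).union (hq _)).insert _
  | alt p q hp hq => exact ((hp _).union (hq _)).insert _
  | star p hp => exact (hp _).insert _

theorem Step.mem_supp {p : Prog Γ} {k x y : List (Prog Γ)} {γ : Γ} {a : Act Γ}
    (hx : x ∈ p.supp k) (h : Step x γ a y) : y ∈ p.supp k ∨ y = k := by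
  induction p generalizing k with
  | act d =>
    obtain rfl : x = _ := hx
    cases h
    exact .inr rfl
  | seq p q hp hq =>
    simp only [supp, Set.mem_insert_iff, Set.mem_union] at hx ⊢
    obtain rfl | hx | hx := hx
    · cases h
      simp [mem_supp_self]
    · obtain h | rfl := hp hx
      · simp [h]
      · simp [mem_supp_self]
    · obtain h | rfl := hq hx
      · simp [h]
      · simp
  | alt p q hp hq =>
    simp only [supp, Set.mem_insert_iff, Set.mem_union] at hx ⊢
    obtain rfl | hx | hx := hx
    · cases h <;> simp [mem_supp_self]
    · obtain h | rfl := hp hx <;> simp [*]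
    · obtain h | rfl := hq hx <;> simp [*]
  | star p hp =>
    simp only [supp, Set.mem_insert_iff] at hx ⊢
    obtain rfl | hx := hx
    · cases h <;> simp [mem_supp_self]
    · obtain h | rfl := hp hx <;> simp [*]

theorem run_write_scan (t : FTape Γ) : (Act.write (t.2 t.1)).run t = t := by
  simp [Act.run]

theorem Step.sem {k k' : List (Prog Γ)} {t t' : FTape Γ} {a : Act Γ}
    (h : Step k (t.2 t.1) a k') (h' : Sem k' (a.run t) t') : Sem k t t' := by
  generalize hγ : t.2 t.1 = γ at h
  cases h with
  | act _ hd => exact ⟨_, ⟨a, hγ ▸ hd, rfl⟩, h'⟩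
  | seq p q k =>
    subst hγ
    rw [run_write_scan] at h'
    obtain ⟨s, hs, s', hs', h'⟩ := h'
    exact ⟨s', ⟨s, hs, hs'⟩, h'⟩
  | altLeft p q k =>
    subst hγ
    rw [run_write_scan] at h'
    obtain ⟨s, hs, h'⟩ := h'
    exact ⟨s, .inl hs, h'⟩
  | altRight p q k =>
    subst hγ
    rw [run_write_scan] at h'
    obtain ⟨s, hs, h'⟩ := h'
    exact ⟨s, .inr hs, h'⟩
  | starNil p k =>
    subst hγ
    rw [run_write_scan] at h'
    exact ⟨t, .refl, h'⟩
  | starCons p k =>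
    subst hγ
    rw [run_write_scan] at h'
    obtain ⟨s, hs, s', hs', h'⟩ := h'
    exact ⟨s', hs'.head hs, h'⟩

/-- One step of the machine executing a stack of programs. -/
def StepC (c c' : List (Prog Γ) × FTape Γ) : Prop :=
  ∃ a, Step c.1 (c.2.2 c.2.1) a c'.1 ∧ c'.2 = a.run c.2

theorem StepC.of_write {k k' : List (Prog Γ)} {t : FTape Γ}
    (h : Step k (t.2 t.1) (.write (t.2 t.1)) k') : StepC (k, t) (k', t) :=
  ⟨_, h, (run_write_scan t).symm⟩

theorem Rel.reach {p : Prog Γ} {t t' : FTape Γ} (h : p.Rel t t') (k : List (Prog Γ)) :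
    ReflTransGen StepC (p :: k, t) (k, t') := by
  induction p generalizing t t' k with
  | act d =>
    obtain ⟨a, ha, rfl⟩ := h
    exact .single ⟨a, .act k ha, rfl⟩
  | seq p q hp hq =>
    obtain ⟨s, hs, hs'⟩ := h
    exact .head (.of_write (.seq p q k _)) ((hp hs _).trans (hq hs' k))
  | alt p q hp hq =>
    obtain h | h := h
    · exact .head (.of_write (.altLeft p q k _)) (hp h k)
    · exact .head (.of_write (.altRight p q k _)) (hq h k)
  | star p hp =>
    induction h using ReflTransGen.head_induction_on with
    | refl => exact .single (.of_write (.starNil p k _))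
    | head h _ ih => exact .head (.of_write (.starCons p k _)) ((hp h _).trans ih)

theorem Sem.reach {k : List (Prog Γ)} {t t' : FTape Γ} (h : Sem k t t') :
    ReflTransGen StepC (k, t) ([], t') := by
  induction k generalizing t with
  | nil => obtain rfl : t = t' := h; exact .refl
  | cons p k ih =>
    obtain ⟨s, hs, h⟩ := h
    exact (hs.reach k).trans (ih h)

end Prog

/-- The positions won by the existential player in the game in which the existential player
moves (at positions marked `true`) along `E` and the universal player along `U`, and
infinite plays are won by the universal player. -/
inductive Game {S : Type*} (E U : S → S → Prop) : Bool → S → Prop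
  | ex {c c' : S} : E c c' → Game E U false c' → Game E U true c
  | univ {c : S} : (∀ c', U c c' → Game E U true c') → Game E U false c

theorem eChain_iff {C : Type*} {isE : C → Bool} {step : C → C → Prop} {c c' : C} :
    EChain isE step c c' ↔ ReflTransGen (fun c c' => isE c = true ∧ step c c') c c' := by
  constructor
  · intro h
    induction h with
    | refl => exact .refl
    | step h h' _ ih => exact .head ⟨h, h'⟩ ih
  · intro h
    induction h using ReflTransGen.head_induction_on with
    | refl => exact .refl _
    | head h _ ih => exact .step h.1 h.2 ih

theorem uChain_iff {C : Type*} {isE : C → Bool} {step : C → C → Prop} {c c' : C} :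
    UChain isE step c c' ↔ ReflTransGen (fun c c' => isE c = false ∧ step c c') c c' := by
  constructor
  · intro h
    induction h with
    | refl => exact .refl
    | step h h' _ ih => exact .head ⟨h, h'⟩ ih
  · intro h
    induction h using ReflTransGen.head_induction_on with
    | refl => exact .refl _
    | head h _ ih => exact .step h.1 h.2 ih

/-- The stacks used by the alternation of `E` and `U`, started with `I`. -/
def gameStacks (I E U : Prog Γ) : Set (List (Prog Γ)) :=
  insert [] (I.supp [] ∪ E.supp [] ∪ U.supp [])

theorem Prog.Step.mem_gameStacks {I E U : Prog Γ} {x y : List (Prog Γ)} {γ : Γ} {a : Act Γ}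
    (hx : x ∈ gameStacks I E U) (h : Prog.Step x γ a y) : y ∈ gameStacks I E U := by
  simp only [gameStacks, Set.mem_insert_iff, Set.mem_union] at hx ⊢
  obtain rfl | (hx | hx) | hx := hx
  · cases h
  all_goals obtain h | h := h.mem_supp hx <;> simp [h]

/-- The machine that runs `I` in universal states, then alternates between running `E` in
existential states and `U` in universal states. -/
def gameATM {α : Type} [Finite Γ] (emb : α ↪ Γ) (blank : Γ) (hb : ∀ a, emb a ≠ blank)
    (I E U : Prog Γ) : ATM α Γ where
  ΓFin := inferInstance
  emb := emb
  blank := blank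
  blank_ne := hb
  Q := Bool × gameStacks I E U
  QFin := by
    have : (gameStacks I E U).Finite :=
      (((I.supp_finite _).union (E.supp_finite _)).union (U.supp_finite _)).insert _
    have := this.to_subtype
    infer_instance
  isE := Prod.fst
  start := (false, ⟨[I], by simp [gameStacks, Prog.mem_supp_self]⟩)
  δ := fun q γ a q' =>
    (q'.1 = q.1 ∧ Prog.Step q.2 γ a q'.2) ∨
      (q.2.1 = [] ∧ a = .write γ ∧ q'.1 = !q.1 ∧ q'.2.1 = [cond q.1 U E])

section

variable {α : Type} [Finite Γ] {emb : α ↪ Γ} {blank : Γ} {hb : ∀ a, emb a ≠ blank}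
  {I E U : Prog Γ}

theorem gameATM_reach {b : Bool} {k : List (Prog Γ)} {t : FTape Γ} {d : List (Prog Γ) × FTape Γ}
    (h : ReflTransGen Prog.StepC (k, t) d) (hk : k ∈ gameStacks I E U) {T : Tape Γ}
    (hT : T.toF blank = t) :
    ∃ (hd : d.1 ∈ gameStacks I E U) (T' : Tape Γ), T'.toF blank = d.2 ∧
      ReflTransGen (fun c c' => (gameATM emb blank hb I E U).cfgE c = b ∧
        (gameATM emb blank hb I E U).Yield c c') ((b, ⟨k, hk⟩), T) ((b, ⟨d.1, hd⟩), T') := by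
  induction h with
  | refl => exact ⟨hk, T, hT, .refl⟩
  | tail _ h ih =>
    obtain ⟨hd, T₁, hT₁, ih⟩ := ih
    obtain ⟨a, ha, h⟩ := h
    obtain ⟨T₂, hT₂⟩ := ActStep.exists_step blank a T₁
    refine ⟨ha.mem_gameStacks hd, T₂, ?_, ih.tail ⟨rfl, a, .inl ⟨rfl, ?_⟩, hT₂⟩⟩
    · rw [hT₂.toF_eq, hT₁, h]
    · rwa [← Tape.toF_scan blank, hT₁]

theorem gameATM_exists_pivot {b : Bool} {k : List (Prog Γ)} {t' : FTape Γ}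
    (hk : k ∈ gameStacks I E U) {T : Tape Γ} (h : Prog.Sem k (T.toF blank) t') :
    ∃ (hk' : [cond b U E] ∈ gameStacks I E U) (T' : Tape Γ), T'.toF blank = t' ∧
      ReflTransGen (fun c c' => (gameATM emb blank hb I E U).cfgE c = b ∧
        (gameATM emb blank hb I E U).Yield c c') ((b, ⟨k, hk⟩), T)
        ((!b, ⟨[cond b U E], hk'⟩), T') := by
  have hk' : [cond b U E] ∈ gameStacks I E U := by
    cases b <;> simp [gameStacks, Prog.mem_supp_self]
  obtain ⟨hd, T', hT', h⟩ := gameATM_reach (b := b) (emb := emb) (hb := hb) h.reach hk rfl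
  obtain ⟨u, γ, v⟩ := T'
  exact ⟨hk', _, hT', h.tail ⟨rfl, .write γ, .inr ⟨rfl, rfl, rfl, rfl⟩, .write u γ γ v⟩⟩

theorem gameATM_pivot {b : Bool} {c c' : (gameATM emb blank hb I E U).Cfg}
    (h : ReflTransGen (fun c c' => (gameATM emb blank hb I E U).cfgE c = b ∧
      (gameATM emb blank hb I E U).Yield c c') c c')
    (hc : c.1.1 = b) (hc' : c'.1.1 = !b) :
    c'.1.2.1 = [cond b U E] ∧ Prog.Sem c.1.2.1 (c.2.toF blank) (c'.2.toF blank) := by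
  induction h using ReflTransGen.head_induction_on with
  | refl => cases b <;> simp_all
  | @head c d h h' ih =>
    obtain ⟨-, a, ⟨hd, ha⟩ | ⟨hk, ha, hd, hd'⟩, hstep⟩ := h
    · obtain ⟨ih₁, ih₂⟩ := ih (hd.trans hc)
      refine ⟨ih₁, Prog.Step.sem (a := a) ?_ (hstep.toF_eq ▸ ih₂)⟩
      rwa [Tape.toF_scan]
    · obtain rfl : d = c' := by
        obtain rfl | ⟨e, he, -⟩ := h'.cases_head
        · rfl
        · have := he.1.symm.trans (hd.trans (congrArg _ hc))
          cases b <;> simp at this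
      have hstep : ActStep blank a c.2 d.2 := hstep
      rw [hd', hk, hc, hstep.toF_eq, ha]
      refine ⟨rfl, ?_⟩
      change _ = _
      rw [← Tape.toF_scan blank, Prog.run_write_scan]

theorem Game.of_accepted {c : (gameATM emb blank hb I E U).Cfg}
    (h : (gameATM emb blank hb I E U).Accepted c) :
    cond c.1.1 (∃ t, Prog.Sem c.1.2.1 (c.2.toF blank) t ∧ Game E.Rel U.Rel false t)
      (∀ t, Prog.Sem c.1.2.1 (c.2.toF blank) t → Game E.Rel U.Rel true t) := by
  induction h with
  | @ex c c' hc hp _ ih =>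
    have hc : c.1.1 = true := hc
    have hc' : c'.1.1 = false := hp.2
    obtain ⟨hk, h⟩ := gameATM_pivot (eChain_iff.1 hp.1) hc hc'
    rw [hc', hk, cond_true, Prog.sem_singleton] at ih
    rw [hc]
    exact ⟨_, h, .univ ih⟩
  | @univ c hc _ ih =>
    have hc : c.1.1 = false := hc
    rw [hc]
    intro t ht
    obtain ⟨⟨b, k, hk⟩, T⟩ := c
    obtain rfl : b = false := hc
    obtain ⟨hk', T', rfl, h⟩ := gameATM_exists_pivot (b := false) (emb := emb) (hb := hb) hk ht
    obtain ⟨s, hs, hs'⟩ := ih _ ⟨uChain_iff.2 h, rfl⟩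
    simp only [cond_false, Prog.sem_singleton] at hs
    exact .ex hs hs'

theorem Game.accepted {b : Bool} {t : FTape Γ} (h : Game E.Rel U.Rel b t)
    (hk : [cond b E U] ∈ gameStacks I E U) {T : Tape Γ} (hT : T.toF blank = t) :
    (gameATM emb blank hb I E U).Accepted ((b, ⟨[cond b E U], hk⟩), T) := by
  induction h generalizing T with
  | @ex t t' ht _ ih =>
    subst hT
    rw [← Prog.sem_singleton] at ht
    obtain ⟨hk', T', hT', h⟩ := gameATM_exists_pivot (b := true) (emb := emb) (hb := hb) hk ht
    exact .ex rfl ⟨eChain_iff.2 h, rfl⟩ (ih hk' hT')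
  | @univ t ht ih =>
    subst hT
    refine .univ rfl ?_
    rintro ⟨⟨b', k', hk'⟩, T'⟩ ⟨h, hb'⟩
    obtain rfl : b' = true := hb'
    obtain ⟨h₁, h₂⟩ := gameATM_pivot (uChain_iff.1 h) rfl rfl
    obtain rfl : k' = [E] := h₁
    exact ih _ (by simpa [Prog.sem_singleton] using h₂) hk' rfl

theorem gameATM_accepts_iff (w : List α) :
    (gameATM emb blank hb I E U).Accepts w ↔
      ∀ t, I.Rel (Tape.toF blank ([], blank, w.map emb)) t → Game E.Rel U.Rel true t := by
  rw [← Prog.sem_singleton]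
  constructor
  · exact Game.of_accepted
  · intro h
    refine .univ rfl ?_
    rintro ⟨⟨b', k', hk'⟩, T'⟩ ⟨hp, hb'⟩
    obtain rfl : b' = true := hb'
    obtain ⟨h₁, h₂⟩ := gameATM_pivot (uChain_iff.1 hp) rfl rfl
    obtain rfl : k' = [E] := h₁
    exact Game.accepted (h _ h₂) hk' rfl

end

end Machine

section Registers

/-- The contents of the registers. -/
abbrev Regs : Type := ℕ → ℕ

variable {α : Type}

/-- The alphabet of a tape carrying a word over `α`, a mark for the leftmost cell, and for each
of `n` registers a mark in the cell whose index is the value of the register. -/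
abbrev Cell (α : Type) (n : ℕ) : Type := Option α × Prop × (Fin n → Prop)

/-- The letter in a given cell of the tape with input `w`. -/
def letter (w : List α) : ℕ → Option α
  | 0 => none
  | i + 1 => w[i]?

/-- The tape that stores the word `w` and the register contents `c`. -/
def encTape (n : ℕ) (w : List α) (c : Regs) : FTape (Cell α n) :=
  (0, fun i => (letter w i, i = 0, fun k => c k = i))

namespace Prog

variable {Γ : Type}

/-- Check a property of the scanned symbol. -/
def test (P : Γ → Prop) : Prog Γ := act fun γ a => P γ ∧ a = .write γ

/-- Rewrite the scanned symbol. -/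
def modify (g : Γ → Γ) : Prog Γ := act fun γ a => a = .write (g γ)

/-- Move the cursor nondeterministically to the right, up to a symbol with property `P`. -/
def seekRight (P : Γ → Prop) : Prog Γ := seq (star (act fun _ a => a = .right)) (test P)

/-- Move the cursor nondeterministically to the left, up to a symbol with property `P`. -/
def seekLeft (P : Γ → Prop) : Prog Γ := seq (star (act fun _ a => a = .left)) (test P)

theorem rel_test {P : Γ → Prop} {t t' : FTape Γ} :
    (test P).Rel t t' ↔ P (t.2 t.1) ∧ t' = t := by
  constructor
  · rintro ⟨_, ⟨h, rfl⟩, rfl⟩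
    exact ⟨h, run_write_scan t⟩
  · rintro ⟨h, rfl⟩
    exact ⟨_, ⟨h, rfl⟩, (run_write_scan _).symm⟩

theorem rel_modify {g : Γ → Γ} {t t' : FTape Γ} :
    (modify g).Rel t t' ↔ t' = (t.1, Function.update t.2 t.1 (g (t.2 t.1))) := by
  constructor
  · rintro ⟨_, rfl, rfl⟩
    rfl
  · rintro rfl
    exact ⟨_, rfl, rfl⟩

theorem rel_right {t t' : FTape Γ} :
    (act fun (_ : Γ) a => a = .right).Rel t t' ↔ t' = (t.1 + 1, t.2) := by
  constructor
  · rintro ⟨_, rfl, rfl⟩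
    rfl
  · rintro rfl
    exact ⟨_, rfl, rfl⟩

theorem rel_left {t t' : FTape Γ} :
    (act fun (_ : Γ) a => a = .left).Rel t t' ↔ t' = (t.1 - 1, t.2) := by
  constructor
  · rintro ⟨_, rfl, rfl⟩
    rfl
  · rintro rfl
    exact ⟨_, rfl, rfl⟩

theorem rel_seq {p q : Prog Γ} {t t' : FTape Γ} :
    (seq p q).Rel t t' ↔ ∃ s, p.Rel t s ∧ q.Rel s t' := Iff.rfl

theorem rel_seekRight {P : Γ → Prop} {i : ℕ} {f : ℕ → Γ} {t' : FTape Γ} :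
    (seekRight P).Rel (i, f) t' ↔ ∃ j, i ≤ j ∧ P (f j) ∧ t' = (j, f) := by
  have key : ∀ t, (star (act fun (_ : Γ) a => a = .right)).Rel (i, f) t ↔
      ∃ j, i ≤ j ∧ t = (j, f) := by
    intro t
    constructor
    · intro h
      induction h with
      | refl => exact ⟨i, le_rfl, rfl⟩
      | tail _ h ih =>
        obtain ⟨j, hj, rfl⟩ := ih
        exact ⟨j + 1, by omega, rel_right.1 h⟩
    · rintro ⟨j, hj, rfl⟩
      induction j, hj using Nat.le_induction with
      | base => exact .refl
      | succ j _ ih => exact ih.tail (rel_right.2 rfl)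
  simp only [seekRight, rel_seq, key, rel_test]
  constructor
  · rintro ⟨_, ⟨j, hj, rfl⟩, h, rfl⟩
    exact ⟨j, hj, h, rfl⟩
  · rintro ⟨j, hj, h, rfl⟩
    exact ⟨_, ⟨j, hj, rfl⟩, h, rfl⟩

theorem rel_seekLeft {P : Γ → Prop} {i : ℕ} {f : ℕ → Γ} {t' : FTape Γ} :
    (seekLeft P).Rel (i, f) t' ↔ ∃ j, j ≤ i ∧ P (f j) ∧ t' = (j, f) := by
  have key : ∀ t, (star (act fun (_ : Γ) a => a = .left)).Rel (i, f) t ↔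
      ∃ j, j ≤ i ∧ t = (j, f) := by
    intro t
    constructor
    · intro h
      induction h with
      | refl => exact ⟨i, le_rfl, rfl⟩
      | tail _ h ih =>
        obtain ⟨j, hj, rfl⟩ := ih
        exact ⟨j - 1, by omega, rel_left.1 h⟩
    · rintro ⟨j, hj, rfl⟩
      induction hj using Nat.decreasingInduction with
      | self => exact .refl
      | of_succ j _ ih => exact ih.tail (rel_left.2 (by simp))
  simp only [seekLeft, rel_seq, key, rel_test]
  constructor
  · rintro ⟨_, ⟨j, hj, rfl⟩, h, rfl⟩
    exact ⟨j, hj, h, rfl⟩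
  · rintro ⟨j, hj, h, rfl⟩
    exact ⟨_, ⟨j, hj, rfl⟩, h, rfl⟩

end Prog

/-- A relation between register contents, depending on an input word, is implemented by a tape
program if sufficiently many registers are available. -/
def Impl (r : List α → Regs → Regs → Prop) : Prop :=
  ∃ N, ∀ n ≥ N, ∃ p : Prog (Cell α n), ∀ w c t,
    p.Rel (encTape n w c) t ↔ ∃ c', r w c c' ∧ t = encTape n w c'

namespace Impl

variable {r s : List α → Regs → Regs → Prop}

theorem of_iff (h : Impl r) (hrs : ∀ w c c', r w c c' ↔ s w c c') : Impl s := by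
  obtain rfl : r = s := by
    funext w c c'
    exact propext (hrs w c c')
  exact h

theorem comp (hr : Impl r) (hs : Impl s) : Impl fun w => Comp (r w) (s w) := by
  obtain ⟨N, hr⟩ := hr
  obtain ⟨N', hs⟩ := hs
  refine ⟨max N N', fun n hn => ?_⟩
  obtain ⟨p, hp⟩ := hr n (le_trans (le_max_left _ _) hn)
  obtain ⟨q, hq⟩ := hs n (le_trans (le_max_right _ _) hn)
  refine ⟨.seq p q, fun w c t => ?_⟩
  simp only [Prog.rel_seq, hp]
  constructor
  · rintro ⟨_, ⟨c', h, rfl⟩, h'⟩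
    obtain ⟨c'', h'', rfl⟩ := (hq _ _ _).1 h'
    exact ⟨c'', ⟨c', h, h''⟩, rfl⟩
  · rintro ⟨c'', ⟨c', h, h'⟩, rfl⟩
    exact ⟨_, ⟨c', h, rfl⟩, (hq _ _ _).2 ⟨_, h', rfl⟩⟩

theorem or (hr : Impl r) (hs : Impl s) : Impl fun w c c' => r w c c' ∨ s w c c' := by
  obtain ⟨N, hr⟩ := hr
  obtain ⟨N', hs⟩ := hs
  refine ⟨max N N', fun n hn => ?_⟩
  obtain ⟨p, hp⟩ := hr n (le_trans (le_max_left _ _) hn)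
  obtain ⟨q, hq⟩ := hs n (le_trans (le_max_right _ _) hn)
  refine ⟨.alt p q, fun w c t => ?_⟩
  simp only [Prog.Rel, hp, hq, or_and_right, exists_or]

theorem star (hr : Impl r) : Impl fun w => ReflTransGen (r w) := by
  obtain ⟨N, hr⟩ := hr
  refine ⟨N, fun n hn => ?_⟩
  obtain ⟨p, hp⟩ := hr n hn
  refine ⟨.star p, fun w c t => ?_⟩
  constructor
  · intro h
    induction h with
    | refl => exact ⟨c, .refl, rfl⟩
    | tail _ h ih =>
      obtain ⟨c', h', rfl⟩ := ih
      obtain ⟨c'', h'', rfl⟩ := (hp _ _ _).1 h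
      exact ⟨c'', h'.tail h'', rfl⟩
  · rintro ⟨c', h, rfl⟩
    induction h with
    | refl => exact .refl
    | tail _ h ih => exact ih.tail ((hp _ _ _).2 ⟨_, h, rfl⟩)

theorem false : Impl fun (_ : List α) _ _ => False :=
  ⟨0, fun n _ => ⟨.test fun _ => False, fun w c t => by simp [Prog.rel_test]⟩⟩

theorem exists_mem_list {ι : Type*} {r : ι → List α → Regs → Regs → Prop} (l : List ι)
    (h : ∀ i, Impl (r i)) : Impl fun w c c' => ∃ i ∈ l, r i w c c' := by
  induction l with
  | nil => simpa using false
  | cons i l ih => simpa using (h i).or ih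

theorem exists_fintype {ι : Type*} [Fintype ι] {r : ι → List α → Regs → Regs → Prop}
    (h : ∀ i, Impl (r i)) : Impl fun w c c' => ∃ i, r i w c c' := by
  simpa using exists_mem_list Finset.univ.toList h

/-- Check whether a register is zero. -/
theorem zeroTest (i : ℕ) : Impl fun (_ : List α) c c' => c i = 0 ∧ c' = c := by
  refine ⟨i + 1, fun n hn => ⟨.test fun γ => γ.2.2 ⟨i, hn⟩, fun w c t => ?_⟩⟩
  simp [Prog.rel_test, encTape, and_assoc]

/-- Check whether two registers have the same value. -/
theorem eqTest (i j : ℕ) : Impl fun (_ : List α) c c' => c i = c j ∧ c' = c := by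
  refine ⟨max i j + 1, fun n hn => ?_⟩
  have hi : i < n := by omega
  have hj : j < n := by omega
  refine ⟨.seq (.seekRight fun γ => γ.2.2 ⟨i, hi⟩ ∧ γ.2.2 ⟨j, hj⟩) (.seekLeft fun γ => γ.2.1),
    fun w c t => ?_⟩
  simp only [encTape, Prog.rel_seq, Prog.rel_seekRight]
  constructor
  · rintro ⟨_, ⟨k, -, ⟨h, h'⟩, rfl⟩, h''⟩
    obtain ⟨j, -, rfl, rfl⟩ := Prog.rel_seekLeft.1 h''
    exact ⟨c, ⟨h.trans h'.symm, rfl⟩, rfl⟩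
  · rintro ⟨c, ⟨h, rfl⟩, rfl⟩
    exact ⟨_, ⟨c i, Nat.zero_le _, ⟨rfl, h.symm⟩, rfl⟩,
      Prog.rel_seekLeft.2 ⟨0, Nat.zero_le _, rfl, rfl⟩⟩

/-- Check the letter at the position stored in a register. -/
theorem readTest (i : ℕ) (a : Option α) :
    Impl fun w c c' => letter w (c i) = a ∧ c' = c := by
  refine ⟨i + 1, fun n hn => ?_⟩
  refine ⟨.seq (.seekRight fun γ => γ.2.2 ⟨i, hn⟩ ∧ γ.1 = a) (.seekLeft fun γ => γ.2.1),
    fun w c t => ?_⟩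
  simp only [encTape, Prog.rel_seq, Prog.rel_seekRight]
  constructor
  · rintro ⟨_, ⟨k, -, ⟨rfl, h'⟩, rfl⟩, h''⟩
    obtain ⟨j, -, rfl, rfl⟩ := Prog.rel_seekLeft.1 h''
    exact ⟨c, ⟨h', rfl⟩, rfl⟩
  · rintro ⟨c, ⟨h, rfl⟩, rfl⟩
    exact ⟨_, ⟨c i, Nat.zero_le _, ⟨rfl, h⟩, rfl⟩,
      Prog.rel_seekLeft.2 ⟨0, Nat.zero_le _, rfl, rfl⟩⟩

/-- Set or remove the mark of a register. -/
def setMark {n : ℕ} (i : Fin n) (b : Prop) (γ : Cell α n) : Cell α n :=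
  (γ.1, γ.2.1, Function.update γ.2.2 i b)

theorem update_setMark {n : ℕ} (w : List α) (c : Regs) (i : Fin n) (m : ℕ) {f : ℕ → Cell α n}
    (hf : f = Function.update (encTape n w c).2 (c i)
      (setMark i False ((encTape n w c).2 (c i)))) :
    Function.update f m (setMark i True (f m)) = (encTape n w (Function.update c i m)).2 := by
  have hf' : ∀ x, f x = (letter w x, x = 0, fun k => k ≠ i ∧ c k = x) := by
    intro x
    rw [hf]
    by_cases hx : x = c i
    · subst hx
      simp only [Function.update_self, encTape, setMark, Prod.mk.injEq, true_and]
      funext k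
      by_cases hk : k = i <;> simp [hk]
    · simp only [Function.update_of_ne hx, encTape, Prod.mk.injEq, true_and]
      funext k
      refine propext ⟨fun h => ⟨?_, h⟩, And.right⟩
      rintro rfl
      exact hx h.symm
  funext x
  by_cases hx : x = m
  · subst hx
    simp only [Function.update_self, hf', setMark, encTape, Prod.mk.injEq, true_and]
    funext k
    by_cases hk : k = i
    · simp [hk]
    · have : (k : ℕ) ≠ i := fun h => hk (Fin.ext h)
      simp [hk, this]
  · simp only [Function.update_of_ne hx, hf', encTape, Prod.mk.injEq, true_and]
    funext k
    by_cases hk : k = i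
    · simp [hk, Ne.symm hx]
    · have : (k : ℕ) ≠ i := fun h => hk (Fin.ext h)
      simp [hk, this]

theorem home_iff {n : ℕ} (w : List α) (c : Regs) (i : Fin n) (b : Prop) (j x : ℕ) :
    (Function.update (encTape n w c).2 j (setMark i b ((encTape n w c).2 j)) x).2.1 ↔ x = 0 := by
  by_cases hx : x = j
  · subst hx
    simp [setMark, encTape]
  · simp [hx, encTape]

/-- Set a register to zero. -/
theorem reset (i : ℕ) :
    Impl fun (_ : List α) c c' => c' = Function.update c i 0 := by
  refine ⟨i + 1, fun n hn => ?_⟩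
  refine ⟨.seq (.seekRight fun γ => γ.2.2 ⟨i, hn⟩) (.seq (.modify (setMark ⟨i, hn⟩ False))
    (.seq (.seekLeft fun γ => γ.2.1) (.modify (setMark ⟨i, hn⟩ True)))), fun w c t => ?_⟩
  simp only [exists_eq_left]
  have key := update_setMark w c ⟨i, hn⟩ 0 rfl
  constructor
  · rintro ⟨_, h₁, _, h₂, _, h₃, h₄⟩
    obtain ⟨j, -, rfl, rfl⟩ := Prog.rel_seekRight.1 h₁
    obtain rfl := Prog.rel_modify.1 h₂
    obtain ⟨j, -, hj, rfl⟩ := Prog.rel_seekLeft.1 h₃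
    obtain rfl := Prog.rel_modify.1 h₄
    obtain rfl := (home_iff w c _ _ _ _).1 hj
    exact Prod.ext rfl key
  · rintro rfl
    exact ⟨_, Prog.rel_seekRight.2 ⟨c i, Nat.zero_le _, rfl, rfl⟩, _, Prog.rel_modify.2 rfl, _,
      Prog.rel_seekLeft.2 ⟨0, Nat.zero_le _, (home_iff w c _ _ _ _).2 rfl, rfl⟩,
      Prog.rel_modify.2 (Prod.ext rfl key.symm)⟩

theorem rel_shift {n i : ℕ} (hn : i < n) (w : List α) (c : Regs) (t : FTape (Cell α n)) :
    (Prog.seq (.modify (setMark ⟨i, hn⟩ False)) (.seq (.act fun _ a => a = .right)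
      (.modify (setMark ⟨i, hn⟩ True)))).Rel (c i, (encTape n w c).2) t ↔
    t = (c i + 1, (encTape n w (Function.update c i (c i + 1))).2) := by
  simp only [Prog.rel_seq, Prog.rel_modify, Prog.rel_right, exists_eq_left]
  rw [update_setMark w c ⟨i, hn⟩ (c i + 1) rfl]

/-- Increment a register. -/
theorem inc (i : ℕ) :
    Impl fun (_ : List α) c c' => c' = Function.update c i (c i + 1) := by
  refine ⟨i + 1, fun n hn => ?_⟩
  refine ⟨.seq (.seekRight fun γ => γ.2.2 ⟨i, hn⟩) (.seq (.seq (.modify (setMark ⟨i, hn⟩ False))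
    (.seq (.act fun _ a => a = .right) (.modify (setMark ⟨i, hn⟩ True))))
    (.seekLeft fun γ => γ.2.1)), fun w c t => ?_⟩
  simp only [exists_eq_left]
  constructor
  · rintro ⟨_, h₁, _, h₂, h₃⟩
    obtain ⟨j, -, rfl, rfl⟩ := Prog.rel_seekRight.1 h₁
    obtain rfl := (rel_shift hn w c _).1 h₂
    obtain ⟨j, -, rfl, rfl⟩ := Prog.rel_seekLeft.1 h₃
    rfl
  · rintro rfl
    exact ⟨_, Prog.rel_seekRight.2 ⟨c i, Nat.zero_le _, rfl, rfl⟩, _, (rel_shift hn w c _).2 rfl,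
      Prog.rel_seekLeft.2 ⟨0, Nat.zero_le _, rfl, rfl⟩⟩

end Impl

end Registers

section Programs

variable {α : Type}

/-- There is a program that always has some outcome, all of whose outcomes satisfy a
postcondition relating the input word, the old and the new register contents. -/
def Ensures (Post : List α → Regs → Regs → Prop) : Prop :=
  ∃ r, Impl r ∧ ∀ w c, (∃ c', r w c c') ∧ ∀ c', r w c c' → Post w c c'

/-- There is a program that assigns the value `F` to register `o`, without changing any other
register below `b`. -/
def Assign (b o : ℕ) (F : List α → Regs → ℕ) : Prop :=
  Ensures fun w c c' => c' o = F w c ∧ ∀ j < b, j ≠ o → c' j = c j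

namespace Ensures

variable {P Q T : List α → Regs → Regs → Prop}

theorem mono (h : Ensures P) (hPQ : ∀ w c c', P w c c' → Q w c c') : Ensures Q := by
  obtain ⟨r, hr, h⟩ := h
  exact ⟨r, hr, fun w c => ⟨(h w c).1, fun c' hc => hPQ _ _ _ ((h w c).2 c' hc)⟩⟩

theorem seq (hP : Ensures P) (hQ : Ensures Q)
    (h : ∀ w c c' c'', P w c c' → Q w c' c'' → T w c c'') : Ensures T := by
  obtain ⟨r, hr, hP⟩ := hP
  obtain ⟨s, hs, hQ⟩ := hQ
  refine ⟨_, hr.comp hs, fun w c => ⟨?_, ?_⟩⟩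
  · obtain ⟨c', h'⟩ := (hP w c).1
    obtain ⟨c'', h''⟩ := (hQ w c').1
    exact ⟨c'', c', h', h''⟩
  · rintro c'' ⟨c', h', h''⟩
    exact h _ _ _ _ ((hP w c).2 _ h') ((hQ w c').2 _ h'')

theorem reset (o : ℕ) : Ensures fun (_ : List α) c c' => c' = Function.update c o 0 :=
  ⟨_, .reset o, fun _ _ => ⟨⟨_, rfl⟩, fun _ h => h⟩⟩

theorem inc (o : ℕ) : Ensures fun (_ : List α) c c' => c' = Function.update c o (c o + 1) :=
  ⟨_, .inc o, fun _ _ => ⟨⟨_, rfl⟩, fun _ h => h⟩⟩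

/-- A loop with an invariant depending on the number of iterations. The body may also be executed
only partially correctly, that is, it can get stuck, except when this is excluded by `hex`. -/
theorem loop {test : List α → Regs → Prop} {body : List α → Regs → Regs → Prop}
    (Inv : List α → Regs → ℕ → Regs → Prop)
    (hI : Ensures fun w c c' => Inv w c 0 c') (hB : Impl body)
    (hT : Impl fun w c c' => test w c ∧ c' = c)
    (hstep : ∀ w c i c' c'', Inv w c i c' → body w c' c'' → Inv w c (i + 1) c'')
    (hex : ∀ w c, ∃ i, (∀ k < i, ∀ c', Inv w c k c' → ∃ c'', body w c' c'') ∧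
      ∀ c', Inv w c i c' → test w c')
    (hP : ∀ w c i c', Inv w c i c' → test w c' → P w c c') : Ensures P := by
  obtain ⟨r, hr, hI⟩ := hI
  refine ⟨_, hr.comp (hB.star.comp hT), fun w c => ⟨?_, ?_⟩⟩
  · obtain ⟨c₀, h₀⟩ := (hI w c).1
    obtain ⟨i, hi, ht⟩ := hex w c
    have key : ∀ k ≤ i, ∃ c', ReflTransGen (body w) c₀ c' ∧ Inv w c k c' := by
      intro k hk
      induction k with
      | zero => exact ⟨c₀, .refl, (hI w c).2 _ h₀⟩
      | succ k ih =>
        obtain ⟨c', h, h'⟩ := ih (by omega)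
        obtain ⟨c'', h''⟩ := hi k hk c' h'
        exact ⟨c'', h.tail h'', hstep _ _ _ _ _ h' h''⟩
    obtain ⟨c', h, h'⟩ := key i le_rfl
    exact ⟨c', c₀, h₀, c', h, ht _ h', rfl⟩
  · rintro c' ⟨c₀, h₀, _, h, ht, rfl⟩
    have key : ∃ k, Inv w c k c' := by
      clear ht
      induction h with
      | refl => exact ⟨0, (hI w c).2 _ h₀⟩
      | tail _ h ih => exact ih.elim fun k hk => ⟨k + 1, hstep _ _ _ _ _ hk h⟩
    obtain ⟨k, hk⟩ := key
    exact hP _ _ _ _ hk ht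

theorem copy {r o : ℕ} (h : r ≠ o) :
    Ensures fun (_ : List α) c c' => c' = Function.update c o (c r) := by
  refine loop (fun _ c i c' => c' = Function.update c o i) (reset o) (.inc o) (.eqTest o r) ?_ ?_ ?_
  · rintro w c i _ _ rfl rfl
    simp
  · refine fun w c => ⟨c r, fun _ _ _ _ => ⟨_, rfl⟩, ?_⟩
    rintro _ rfl
    simp [h]
  · rintro w c i _ rfl h'
    simp only [Function.update_self, ne_eq, h, not_false_eq_true, Function.update_of_ne] at h'
    rw [h']

end Ensures

namespace Assign

theorem ofFn_comp {n m : ℕ} {f : List.Vector ℕ n → ℕ} {g : Fin n → List.Vector ℕ m → ℕ}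
    {ι : Fin m → ℕ} {b o : ℕ} (ho : o < b)
    (hf : ∀ {ι : Fin n → ℕ} {b : ℕ}, o < b → (∀ i, ι i < b) → (∀ i, ι i ≠ o) →
      Assign b o fun (_ : List α) c => f (.ofFn fun i => c (ι i)))
    (hg : ∀ i {o b : ℕ}, o < b → (∀ i, ι i < b) → (∀ i, ι i ≠ o) →
      Assign b o fun (_ : List α) c => g i (.ofFn fun i => c (ι i)))
    (hb : ∀ i, ι i < b) :
    Assign b o fun (_ : List α) c => f (.ofFn fun i => g i (.ofFn fun i => c (ι i))) := by
  have key : ∀ k ≤ n, Ensures fun (_ : List α) c c' => (∀ j < b, c' j = c j) ∧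
      ∀ i : Fin n, i < k → c' (b + i) = g i (.ofFn fun i => c (ι i)) := by
    intro k hk
    induction k with
    | zero => exact ⟨_, .eqTest 0 0, fun w c => ⟨⟨c, rfl, rfl⟩, by rintro _ ⟨-, rfl⟩; simp⟩⟩
    | succ k ih =>
      refine (ih (by omega)).seq (hg ⟨k, hk⟩ (o := b + k) (b := b + n) (by omega)
        (fun i => (hb i).trans_le (by omega)) fun i => ((hb i).trans_le (by omega)).ne) ?_
      rintro w c c' c'' ⟨h₁, h₂⟩ ⟨h₃, h₄⟩
      refine ⟨fun j hj => by rw [h₄ j (by omega) (by omega), h₁ j hj], fun i hi => ?_⟩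
      obtain hi | hi := Nat.lt_succ_iff_lt_or_eq.1 hi
      · rw [h₄ _ (by omega) (by omega), h₂ i hi]
      · obtain rfl : i = ⟨k, hk⟩ := Fin.ext hi
        simp only [h₃, h₁ _ (hb _)]
  refine (key n le_rfl).seq (hf (ι := fun i => b + i) (b := b + n) (by omega) (fun i => by omega)
    fun i => by omega) ?_
  rintro w c c' c'' ⟨h₁, h₂⟩ ⟨h₃, h₄⟩
  refine ⟨?_, fun j hj hjo => by rw [h₄ j (by omega) hjo, h₁ j hj]⟩
  simp only [h₃, h₂ _ (Fin.is_lt _)]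

/-- Primitive recursive functions can be computed by register programs. -/
theorem of_primrec' {n : ℕ} {f : List.Vector ℕ n → ℕ} (hf : Nat.Primrec' f) :
    ∀ {ι : Fin n → ℕ} {o b : ℕ}, o < b → (∀ i, ι i < b) → (∀ i, ι i ≠ o) →
      Assign b o fun (_ : List α) c => f (.ofFn fun i => c (ι i)) := by
  induction hf with
  | zero =>
    intro ι o b ho hb hι
    refine (Ensures.reset o).mono ?_
    rintro w c _ rfl
    simp +contextual
  | succ =>
    intro ι o b ho hb hι
    refine (Ensures.copy (hι 0)).seq (.inc o) ?_
    rintro w c _ _ rfl rfl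
    simp +contextual [List.Vector.head_ofFn]
  | get i =>
    intro ι o b ho hb hι
    refine (Ensures.copy (hι i)).mono ?_
    rintro w c _ rfl
    simp +contextual
  | comp g hf hg ihf ihg =>
    intro ι o b ho hb hι
    exact ofFn_comp ho ihf (fun i _ _ => ihg i) hb
  | @prec n f g hf hg ihf ihg =>
    intro ι o b ho hb hι
    let v (c : Regs) : List.Vector ℕ n := .ofFn fun i => c (ι i.succ)
    let val (c : Regs) (k : ℕ) : ℕ :=
      k.rec (f (v c)) fun y IH => g (y ::ᵥ IH ::ᵥ v c)
    have hv : ∀ {c c' : Regs}, (∀ j < b, c' j = c j) → v c' = v c := fun {c c'} h => by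
      simp only [v, h _ (hb _)]
    have hbody : Ensures fun (_ : List α) c c' => (∀ j < b, c' j = c j) ∧ c' b = c b + 1 ∧
        c' (b + 1) = g (c b ::ᵥ c (b + 1) ::ᵥ v c) := by
      have h₁ : Assign (b + 3) (b + 2) fun (_ : List α) c => g (c b ::ᵥ c (b + 1) ::ᵥ v c) :=
        ihg (ι := Fin.cons b (Fin.cons (b + 1) fun i => ι i.succ)) (by omega)
          (by
            refine Fin.cases (by simp) (Fin.cases (by simp) fun i => ?_)
            exact (hb i.succ).trans (by omega))
          (by
            refine Fin.cases (by simp) (Fin.cases (by simp) fun i => ?_)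
            exact ((hb i.succ).trans (by omega)).ne)
      refine h₁.seq ((Ensures.copy (r := b + 2) (o := b + 1) (by omega)).seq (.inc b)
        (T := fun _ c c' => c' b = c b + 1 ∧ c' (b + 1) = c (b + 2) ∧ ∀ j < b, c' j = c j)
        ?_) ?_
      · rintro w c _ _ rfl rfl
        simp +contextual [Function.update_apply, LT.lt.ne]
        omega
      · rintro w c c' c'' ⟨h₁, h₂⟩ ⟨h₃, h₄, h₅⟩
        refine ⟨fun j hj => ?_, ?_, ?_⟩
        · rw [h₅ j hj, h₂ j (by omega) (by omega)]
        · rw [h₃, h₂ b (by omega) (by omega)]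
        · rw [h₄, h₁]
    have hinit : Ensures fun (_ : List α) c c' => (∀ j < b, c' j = c j) ∧ c' b = 0 ∧
        c' (b + 1) = f (v c) := by
      refine (ihf (ι := fun i => ι i.succ) (o := b + 1) (b := b + 2) (by omega)
        (fun i => (hb i.succ).trans (by omega)) fun i => ((hb i.succ).trans (by omega)).ne).seq
        (.reset b) ?_
      rintro w c c' _ ⟨h₁, h₂⟩ rfl
      refine ⟨fun j hj => ?_, by simp, by simp [h₁, v]⟩
      rw [Function.update_of_ne hj.ne, h₂ j (by omega) (by omega)]
    obtain ⟨r, hr, hbody⟩ := hbody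
    have hloop : Ensures fun (_ : List α) c c' => (∀ j < b, c' j = c j) ∧
        c' (b + 1) = val c (c (ι 0)) := by
      refine .loop (fun _ c i c' => (∀ j < b, c' j = c j) ∧ c' b = i ∧ c' (b + 1) = val c i)
        hinit hr (.eqTest b (ι 0)) ?_ ?_ ?_
      · rintro w c i c' c'' ⟨h₁, h₂, h₃⟩ h
        obtain ⟨h₄, h₅, h₆⟩ := (hbody w c').2 _ h
        refine ⟨fun j hj => by rw [h₄ j hj, h₁ j hj], by rw [h₅, h₂], ?_⟩
        rw [h₆, hv h₁, h₂, h₃]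
      · refine fun w c => ⟨c (ι 0), fun _ _ c' _ => (hbody w c').1, fun c' h => ?_⟩
        rw [h.2.1, h.1 _ (hb 0)]
      · rintro w c i c' ⟨h₁, rfl, h₃⟩ h
        refine ⟨h₁, ?_⟩
        rw [h₃, h, h₁ _ (hb 0)]
    refine hloop.seq (.copy (r := b + 1) (o := o) (by omega)) ?_
    rintro w c c' _ ⟨h₁, h₂⟩ rfl
    refine ⟨?_, fun j hj hjo => by rw [Function.update_of_ne hjo, h₁ j hj]⟩
    dsimp only
    rw [Function.update_self, h₂, List.Vector.head_ofFn, List.Vector.tail_ofFn]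

/-- Primitive recursive functions can be computed by register programs, even in place. -/
theorem of_primrec {n : ℕ} {f : List.Vector ℕ n → ℕ} (hf : Primrec f) {ι : Fin n → ℕ} {o b : ℕ}
    (ho : o < b) (hb : ∀ i, ι i < b) :
    Assign b o fun (_ : List α) c => f (.ofFn fun i => c (ι i)) := by
  refine (of_primrec' (Nat.Primrec'.of_prim hf) (ι := ι) (o := b) (b := b + 1) (by omega)
    (fun i => (hb i).trans (by omega)) fun i => (hb i).ne).seq (.copy ho.ne') ?_
  rintro w c c' _ ⟨h₁, h₂⟩ rfl
  refine ⟨by rw [Function.update_self, h₁], fun j hj hjo => ?_⟩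
  rw [Function.update_of_ne hjo, h₂ j (by omega) (by omega)]

/-- Add an entry in front of the list whose code is stored in a register. -/
theorem cons {x o b : ℕ} (ho : o < b) (hx : x < b) :
    Assign b o fun (_ : List α) c => Nat.succ (Nat.pair (c x) (c o)) := by
  refine of_primrec (f := fun v => Nat.succ (Nat.pair (v.get 0) (v.get 1))) ?_ (ι := ![x, o]) ho
    (by simp [Fin.forall_fin_two, ho, hx])
  exact Primrec.succ.comp (Primrec₂.natPair.comp
    (Primrec.vector_get.comp .id (.const 0)) (Primrec.vector_get.comp .id (.const 1)))

/-- Store the code of the reversed input word. -/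
theorem input [Fintype α] [Encodable α] {o b : ℕ} (ho : o < b) :
    Assign b o fun (w : List α) _ => Encodable.encode w.reverse := by
  have hcons : ∀ a : α, Assign (b + 1) o fun (_ : List α) c =>
      Nat.succ (Nat.pair (Encodable.encode a) (c o)) := by
    intro a
    refine of_primrec (f := fun v => Nat.succ (Nat.pair (Encodable.encode a) (v.get 0))) ?_
      (ι := ![o]) (by omega) (by simp; omega)
    exact Primrec.succ.comp (Primrec₂.natPair.comp (.const _)
      (Primrec.vector_get.comp .id (.const 0)))
  choose r hr hcons using hcons
  have hinit : Ensures fun (_ : List α) c c' => (∀ j < b, j ≠ o → c' j = c j) ∧ c' b = 1 ∧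
      c' o = 0 := by
    refine (Ensures.reset o).seq ((Ensures.reset b).seq (.inc b)
      (T := fun _ c c' => c' = Function.update c b 1) ?_) ?_
    · rintro w c _ _ rfl rfl
      simp
    · rintro w c _ _ rfl rfl
      simp +contextual [ho.ne, LT.lt.ne]
  refine .loop (test := fun w c => letter w (c b) = none)
    (fun w c i c' => (∀ j < b, j ≠ o → c' j = c j) ∧ c' b = i + 1 ∧
    c' o = Encodable.encode (w.take i).reverse ∧ i ≤ w.length) (hinit.mono ?_)
    (Impl.exists_fintype fun a : α => (Impl.readTest b (some a)).comp ((hr a).comp (.inc b)))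
    (.readTest b none) ?_ ?_ ?_
  · rintro w c c' ⟨h₁, h₂, h₃⟩
    exact ⟨h₁, h₂, by simp [h₃], by simp⟩
  · rintro w c i c' _ ⟨h₁, h₂, h₃, h₄⟩ ⟨a, _, ⟨ha, rfl⟩, c'', h, rfl⟩
    obtain ⟨h₅, h₆⟩ := (hcons a w _).2 _ h
    rw [h₂] at ha
    obtain ⟨hi, ha⟩ := List.getElem?_eq_some_iff.1 ha
    refine ⟨fun j hj hjo => ?_, ?_, ?_, hi⟩
    · rw [Function.update_of_ne hj.ne, h₆ j (by omega) hjo, h₁ j hj hjo]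
    · rw [Function.update_self, h₆ b (by omega) ho.ne', h₂]
    · rw [Function.update_of_ne ho.ne, h₅, List.take_succ_eq_append_getElem hi,
        List.reverse_append, ha]
      dsimp only
      rw [h₃]
      simp
  · refine fun w c => ⟨w.length, ?_, ?_⟩
    · rintro i hi c' ⟨-, h, -⟩
      obtain ⟨c'', h'⟩ := (hcons w[i] w c').1
      exact ⟨_, w[i], _, ⟨by rw [h]; simp [letter, hi], rfl⟩, _, h', rfl⟩
    · rintro c' ⟨-, h, -⟩
      rw [h]
      simp [letter]
  · rintro w c i c' ⟨h₁, h₂, h₃, h₄⟩ h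
    rw [h₂] at h
    have := List.getElem?_eq_none_iff.1 h
    refine ⟨by rw [h₃, List.take_of_length_le this], h₁⟩

end Assign

end Programs

section Inductive

theorem Game.iff_map {S T : Type*} {E U : S → S → Prop} {E' U' : T → T → Prop} {φ : S → T}
    (hE : ∀ c t, E' (φ c) t ↔ ∃ c', E c c' ∧ t = φ c')
    (hU : ∀ c t, U' (φ c) t ↔ ∃ c', U c c' ∧ t = φ c') {b : Bool} {c : S} :
    Game E' U' b (φ c) ↔ Game E U b c := by
  constructor
  · generalize hx : φ c = x
    intro h
    induction h generalizing c with
    | ex h _ ih =>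
      subst hx
      obtain ⟨c', h', rfl⟩ := (hE _ _).1 h
      exact .ex h' (ih rfl)
    | univ _ ih =>
      subst hx
      exact .univ fun c' h' => ih _ ((hU _ _).2 ⟨c', h', rfl⟩) rfl
  · intro h
    induction h with
    | ex h _ ih => exact .ex ((hE _ _).2 ⟨_, h, rfl⟩) ih
    | univ _ ih =>
      refine .univ fun t ht => ?_
      obtain ⟨c', h', rfl⟩ := (hU _ _).1 ht
      exact ih c' h'

/-- In a game on registers, the universal player successively chooses the values of a function.
The existential player can either store the last value in a history of choices or win by showing
that the history has a property `D`. -/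
theorem Game.iff_forall_exists {D : List ℕ → Prop} {A B U : Regs → Regs → Prop}
    (hU : ∀ c c', U c c' ↔ c 0 = 0 ∧ ∃ m, c' = Function.update c 1 m)
    (hA : ∀ (c : Regs) (l : List ℕ) c', c 2 = Encodable.encode l → A c c' → D (c 1 :: l).reverse)
    (hA' : ∀ (c : Regs) (l : List ℕ), c 2 = Encodable.encode l → D (c 1 :: l).reverse →
      ∃ c', A c c' ∧ c' 0 ≠ 0)
    (hB : ∀ c, ∃ c', B c c')
    (hB' : ∀ c c', B c c' → c' 0 = c 0 ∧ c' 2 = Nat.succ (Nat.pair (c 1) (c 2))) :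
    Game (fun c c' => A c c' ∨ B c c') U false (fun _ => 0) ↔
      ∀ g : ℕ → ℕ, ∃ n, D ((List.range (n + 1)).map g) := by
  have hcons : ∀ {c c' : Regs} {l : List ℕ}, c 2 = Encodable.encode l → B c c' →
      c' 2 = Encodable.encode (c 1 :: l) := fun {c c' l} h h' => by
    rw [(hB' _ _ h').2, h]
    rfl
  constructor
  · intro h g
    have key : ∀ b c, Game (fun c c' => A c c' ∨ B c c') U b c → c 0 = 0 → ∀ (l : List ℕ) n,
        c 2 = Encodable.encode l → (List.range n).map g = l.reverse → (b = true → c 1 = g n) →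
        ∃ n, D ((List.range (n + 1)).map g) := by
      intro b c h
      induction h with
      | @ex c c' h _ ih =>
        intro h₀ l n hl hn hb
        have hn' : (List.range (n + 1)).map g = (c 1 :: l).reverse := by
          rw [List.range_succ, List.map_append, hn, hb rfl, List.reverse_cons]
          rfl
        obtain h | h := h
        · exact ⟨n, hn' ▸ hA c l c' hl h⟩
        · exact ih ((hB' _ _ h).1.trans h₀) _ _ (hcons hl h) hn' (by simp)
      | @univ c _ ih =>
        intro h₀ l n hl hn _
        exact ih (Function.update c 1 (g n)) ((hU _ _).2 ⟨h₀, _, rfl⟩) (by simpa) l n (by simpa) hn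
          (by simp)
    exact key _ _ h rfl [] 0 rfl rfl (by simp)
  · contrapose!
    intro h
    let Bad (l : List ℕ) : Prop := ∃ c : Regs, c 0 = 0 ∧ c 2 = Encodable.encode l ∧
      ¬ Game (fun c c' => A c c' ∨ B c c') U false c
    have hstep : ∀ l, Bad l → ∃ m, Bad (m :: l) ∧ ¬ D (m :: l).reverse := by
      rintro l ⟨c, h₀, hl, h⟩
      by_contra! hcon
      refine h (.univ fun c' hc' => ?_)
      obtain ⟨-, m, rfl⟩ := (hU _ _).1 hc'
      have hl' : Function.update c 1 m 2 = Encodable.encode l := by simpa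
      by_cases hD : D (m :: l).reverse
      · obtain ⟨c', h', h₀'⟩ := hA' (Function.update c 1 m) l hl' (by simpa using hD)
        exact .ex (.inl h') (.univ fun c'' h'' => absurd ((hU _ _).1 h'').1 h₀')
      · obtain ⟨c', h'⟩ := hB (Function.update c 1 m)
        refine .ex (.inr h') (by_contra fun hc' => hD (hcon m ⟨c', ?_, ?_, hc'⟩))
        · simpa using (hB' _ _ h').1.trans (by simpa using h₀)
        · simpa using hcons hl' h'
    choose! m hm hmD using hstep
    let s (n : ℕ) : List ℕ := n.rec [] fun _ l => m l :: l
    have hs : ∀ n, Bad (s n) := by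
      intro n
      induction n with
      | zero => exact ⟨_, rfl, rfl, h⟩
      | succ n ih => exact hm _ ih
    have hrange : ∀ n, (List.range n).map (fun k => m (s k)) = (s n).reverse := by
      intro n
      induction n with
      | zero => rfl
      | succ n ih => simp [List.range_succ, ih, s]
    refine ⟨fun k => m (s k), fun n => ?_⟩
    rw [hrange]
    exact hmD _ (hs n)

variable {α : Type}

theorem Impl.choose (o : ℕ) :
    Impl fun (_ : List α) c c' => ∃ m, c' = Function.update c o m := by
  refine ((Impl.reset o).comp (Impl.inc o).star).of_iff fun w c c' => ?_
  constructor
  · rintro ⟨_, rfl, h⟩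
    induction h with
    | refl => exact ⟨0, rfl⟩
    | tail _ h ih =>
      obtain ⟨m, rfl⟩ := ih
      exact ⟨m + 1, by simpa using h⟩
  · rintro ⟨m, rfl⟩
    refine ⟨_, rfl, ?_⟩
    induction m with
    | zero => exact .refl
    | succ m ih => exact ih.tail (by simp)

/-- Search for a zero of a primitive recursive function of the input, registers 2 and 1, and a
nondeterministically chosen number. If it is found, register 0 becomes nonzero. -/
theorem Impl.search [Fintype α] [Encodable α] {h : List.Vector ℕ 4 → ℕ} (hh : Primrec h) :
    ∃ r : List α → Regs → Regs → Prop, Impl r ∧ ∀ w c,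
      (∀ c', r w c c' → ∃ y, h (.ofFn ![Encodable.encode w.reverse, c 2, c 1, y]) = 0) ∧
      ∀ y, h (.ofFn ![Encodable.encode w.reverse, c 2, c 1, y]) = 0 →
        ∃ c', r w c c' ∧ c' 0 ≠ 0 := by
  obtain ⟨r, hr, hr'⟩ := Assign.input (α := α) (o := 3) (b := 4) (by omega)
  obtain ⟨s, hs, hs'⟩ := Assign.of_primrec (α := α) hh (ι := ![3, 2, 1, 4]) (o := 5) (b := 6)
    (by omega) (by decide)
  have key : ∀ {w c c' c''} (y : ℕ), r w c c' → s w (Function.update c' 4 y) c'' →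
      c'' 5 = h (.ofFn ![Encodable.encode w.reverse, c 2, c 1, y]) := by
    intro w c c' c'' y h₁ h₂
    obtain ⟨h₃, h₄⟩ := (hr' _ _).2 _ h₁
    obtain ⟨h₅, -⟩ := (hs' _ _).2 _ h₂
    rw [h₅]
    dsimp only at h₃ ⊢
    congr 2
    funext i
    fin_cases i
    · simpa using h₃
    · simpa using h₄ 2 (by omega) (by omega)
    · simpa using h₄ 1 (by omega) (by omega)
    · simp
  refine ⟨_, hr.comp ((choose 4).comp (hs.comp ((zeroTest 5).comp (inc 0)))), fun w c => ⟨?_, ?_⟩⟩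
  · rintro _ ⟨c', h₁, _, ⟨y, rfl⟩, c'', h₂, _, ⟨h₃, rfl⟩, rfl⟩
    exact ⟨y, by rw [← key y h₁ h₂, h₃]⟩
  · intro y hy
    obtain ⟨c', h₁⟩ := (hr' w c).1
    obtain ⟨c'', h₂⟩ := (hs' w (Function.update c' 4 y)).1
    exact ⟨_, ⟨c', h₁, _, ⟨y, rfl⟩, c'', h₂, _, ⟨by rw [key y h₁ h₂, hy], rfl⟩, rfl⟩, by simp⟩

/-- Computable predicates are projections of zero sets of primitive recursive functions. -/
theorem _root_.ComputablePred.exists_primrec {β γ : Type*} [Primcodable β] [Primcodable γ]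
    {p : β × List γ → Prop} (hp : ComputablePred p) :
    ∃ h : List.Vector ℕ 4 → ℕ, Primrec h ∧ ∀ a m l, p (a, m :: l) ↔
      ∃ y, h (.ofFn ![Encodable.encode a, Encodable.encode l, Encodable.encode m, y]) = 0 := by
  obtain ⟨_, hp⟩ := hp
  obtain ⟨e, he⟩ := Nat.Partrec.Code.exists_code.1 hp
  refine ⟨fun v => if e.evaln (v.get 3) (Nat.pair (v.get 0) (Nat.succ (Nat.pair (v.get 2)
    (v.get 1)))) = some (Encodable.encode true) then 0 else 1, ?_, fun a m l => ?_⟩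
  · have hget : ∀ i : Fin 4, Primrec fun v : List.Vector ℕ 4 => v.get i := fun i =>
      Primrec.vector_get.comp .id (.const i)
    refine .ite (Primrec.eq.comp (Nat.Partrec.Code.primrec_evaln.comp (.pair (.pair (hget 3)
      (.const e)) (Primrec₂.natPair.comp (hget 0) (Primrec.succ.comp (Primrec₂.natPair.comp
      (hget 2) (hget 1)))))) (.const _)) (.const 0) (.const 1)
  · have h : e.eval (Encodable.encode (a, m :: l)) =
        Part.some (Encodable.encode (decide (p (a, m :: l)))) := by
      rw [he]
      simp
    have hval : ∀ y, e.evaln y (Encodable.encode (a, m :: l)) = some (Encodable.encode true) →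
        p (a, m :: l) := fun y hy => by
      have := Nat.Partrec.Code.evaln_sound hy
      rw [h, Part.mem_some_iff] at this
      simpa using (Encodable.encode_injective this).symm
    have hget : ∀ y, (List.Vector.ofFn ![Encodable.encode a, Encodable.encode l,
      Encodable.encode m, y]).get = ![Encodable.encode a, Encodable.encode l,
      Encodable.encode m, y] := fun y => funext fun i => List.Vector.get_ofFn _ _
    simp only [hget]
    constructor
    · intro hp
      obtain ⟨y, hy⟩ := Nat.Partrec.Code.evaln_complete.1
        (show Encodable.encode true ∈ e.eval (Encodable.encode (a, m :: l)) by
          rw [h, decide_eq_true hp]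
          exact Part.mem_some _)
      exact ⟨y, if_pos hy⟩
    · rintro ⟨y, hy⟩
      by_contra hcon
      exact one_ne_zero ((if_neg fun h => hcon (hval y h)).symm.trans hy)

/-- The inductive languages are those defined by a game on registers. -/
theorem IsInductive.exists_game [Fintype α] [Primcodable α] {L : Set (List α)}
    (hL : IsInductive α L) : ∃ E U : List α → Regs → Regs → Prop, Impl E ∧ Impl U ∧
      L = {w | Game (E w) (U w) false fun _ => 0} := by
  obtain ⟨R, hR, rfl⟩ := hL
  let dec (m : ℕ) : List α := (Encodable.decode m).getD []
  have hdec : Primrec dec := Primrec.option_getD.comp .decode (.const [])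
  let D (w : List α) (l : List ℕ) : Prop := R (w, l.map dec)
  have hD : ComputablePred fun x : List α × List ℕ => D x.1.reverse x.2.reverse := by
    obtain ⟨_, hR⟩ := hR
    refine ⟨inferInstance, hR.comp (Primrec.to_comp (.pair (Primrec.list_reverse.comp .fst) ?_))⟩
    exact Primrec.list_map (Primrec.list_reverse.comp .snd) (hdec.comp .snd).to₂
  obtain ⟨h, hh, hD⟩ := hD.exists_primrec
  obtain ⟨A, hA, hA'⟩ := Impl.search (α := α) hh
  obtain ⟨B, hB, hB'⟩ := Assign.cons (α := α) (x := 1) (o := 2) (b := 3) (by omega) (by omega)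
  refine ⟨_, _, hA.or hB, ((Impl.zeroTest 0).comp (Impl.choose 1)), ?_⟩
  ext w
  have hD : ∀ m l, D w (m :: l).reverse ↔
      ∃ y, h (.ofFn ![Encodable.encode w.reverse, Encodable.encode l, m, y]) = 0 := fun m l => by
    have := hD w.reverse m l
    rwa [List.reverse_reverse] at this
  have hgame := Game.iff_forall_exists (D := D w) (A := A w) (B := B w)
    (U := Comp (fun c c' => c 0 = 0 ∧ c' = c) fun c c' => ∃ m, c' = Function.update c 1 m)
    (fun c c' => by simp [Comp]) (fun c l c' hl h' => (hD _ _).2 ?_) (fun c l hl h' => ?_)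
    (fun c => (hB' w c).1) fun c c' h' => ?_
  · rw [Set.mem_ofPred_eq, Set.mem_ofPred_eq, hgame]
    constructor
    · intro H g
      obtain ⟨n, hn⟩ := H fun k => dec (g k)
      refine ⟨n, ?_⟩
      simpa [D, Function.comp_def] using hn
    · intro H f
      obtain ⟨n, hn⟩ := H fun k => Encodable.encode (f k)
      refine ⟨n, ?_⟩
      simpa [D, dec, Function.comp_def] using hn
  · rw [← hl]
    exact (hA' w c).1 c' h'
  · obtain ⟨y, hy⟩ := (hD _ _).1 h'
    rw [← hl] at hy
    exact (hA' w c).2 y hy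
  · obtain ⟨h₁, h₂⟩ := (hB' w c).2 c' h'
    exact ⟨h₂ 0 (by omega) (by omega), h₁⟩

/-- Games on registers are accepted by alternating Turing machines. -/
theorem Game.exists_atm [Finite α] {E U : List α → Regs → Regs → Prop} (hE : Impl E)
    (hU : Impl U) :
    ∃ (Γ : Type) (M : ATM α Γ), M.Lang = {w | Game (E w) (U w) false fun _ => 0} := by
  obtain ⟨N, hE⟩ := hE
  obtain ⟨N', hU⟩ := hU
  obtain ⟨E', hE⟩ := hE (max N N') (le_max_left _ _)
  obtain ⟨U', hU⟩ := hU (max N N') (le_max_right _ _)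
  generalize max N N' = n at E' U'
  let emb : α ↪ Cell α n :=
    ⟨fun a => (some a, False, fun _ => False), fun a b h => by simpa using h⟩
  refine ⟨Cell α n, gameATM emb (none, False, fun _ => False)
    (fun a h => by simpa using congrArg Prod.fst h)
    (.seq (.modify fun _ => (none, True, fun _ => True)) U') E' U', ?_⟩
  ext w
  have hinit : (Tape.toF (none, False, fun _ => False) ([], (none, False, fun _ => False),
      w.map emb)) = ((0, fun i => (letter w i, False, fun _ => False)) : FTape (Cell α n)) := by
    simp only [Tape.toF, List.length_nil, List.nil_append, Prod.mk.injEq, true_and]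
    funext i
    cases i with
    | zero => rfl
    | succ i =>
      cases hi : w[i]? with
      | none => simp [letter, hi]
      | some a => simp [letter, hi, emb, DFunLike.coe]
  have hstart : (0, Function.update (fun i => (letter w i, False, fun _ => False)) 0
      (none, True, fun _ => True)) = encTape n w fun _ => 0 := by
    refine Prod.ext rfl (funext fun i => ?_)
    cases i <;> simp [encTape, letter]
  rw [ATM.Lang, Set.mem_ofPred_eq, gameATM_accepts_iff, Set.mem_ofPred_eq,
    ← Game.iff_map (hE w) (hU w)]
  simp only [Prog.rel_seq, Prog.rel_modify, exists_eq_left, hinit, hstart]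
  constructor
  · exact .univ
  · rintro (_ | h)
    exact h

end Inductive
end ATMPaper
open ATMPaper in
/-- every inductive (`Π¹₁`) language `L ⊆ Σ*` is accepted by
some alternating Turing machine over `Σ`. -/
theorem stmt15 {α : Type} [Fintype α] [Primcodable α] (L : Set (List α))
    (h : IsInductive α L) :
    ∃ (Γ : Type) (M : ATM α Γ), L = M.Lang := by
  obtain ⟨E, U, hE, hU, rfl⟩ := h.exists_game
  obtain ⟨Γ, M, hM⟩ := Game.exists_atm hE hU
  exact ⟨Γ, M, hM.symm⟩
end
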